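/- arXiv:2406.15086 — 3 statements merged into one kernel-verified Lean document; each statement's English description precedes it below -/
import Mathlib

section
/- Assume additionally that the map (h,x) ∈ H×K₀ ↦ A_{(h,x)} is continuous for the Hausdorff distance on nonempty compact subsets of ℝᵐ. Then lim_{k→∞} dist(y_{ε_k}(t₀/ε_k), A_{(g·(t₀/ε_k), x₀(t₀))}) = 0. -/
open Filter Topology Metric Set

noncomputable section

/-- The time-translate h·s of a map, as a continuous map. -/
def timeTranslate {n m : ℕ} (s : ℝ)
    (h : C(EuclideanSpace ℝ (Fin n) × EuclideanSpace ℝ (Fin m) × ℝ,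
      EuclideanSpace ℝ (Fin m))) :
    C(EuclideanSpace ℝ (Fin n) × EuclideanSpace ℝ (Fin m) × ℝ,
      EuclideanSpace ℝ (Fin m)) :=
  ⟨fun p => h (p.1, p.2.1, p.2.2 + s), h.continuous.comp (by fun_prop)⟩

/-- Admissibility: bounded and uniformly continuous on K × ℝ for every compact K. -/
def IsAdmissibleMap {n m : ℕ}
    (g : C(EuclideanSpace ℝ (Fin n) × EuclideanSpace ℝ (Fin m) × ℝ,
      EuclideanSpace ℝ (Fin m))) : Prop :=
  ∀ K : Set (EuclideanSpace ℝ (Fin n) × EuclideanSpace ℝ (Fin m)), IsCompact K →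
    (∃ C : ℝ, ∀ x y (τ : ℝ), (x, y) ∈ K → ‖g (x, y, τ)‖ ≤ C) ∧
    (∀ ε > (0:ℝ), ∃ δ > (0:ℝ), ∀ x y (τ : ℝ) x' y' (τ' : ℝ), (x, y) ∈ K → (x', y') ∈ K →
      dist ((x, y, τ) : EuclideanSpace ℝ (Fin n) × EuclideanSpace ℝ (Fin m) × ℝ)
        (x', y', τ') < δ → dist (g (x, y, τ)) (g (x', y', τ')) < ε)

/-- Uniform Lipschitz continuity in y on compact sets. -/
def IsLipschitzInY {n m : ℕ}
    (g : C(EuclideanSpace ℝ (Fin n) × EuclideanSpace ℝ (Fin m) × ℝ,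
      EuclideanSpace ℝ (Fin m))) : Prop :=
  ∀ K₀ : Set (EuclideanSpace ℝ (Fin n)), IsCompact K₀ →
    ∀ K : Set (EuclideanSpace ℝ (Fin m)), IsCompact K →
      ∃ L > (0:ℝ), ∀ x ∈ K₀, ∀ y₁ ∈ K, ∀ y₂ ∈ K, ∀ τ : ℝ,
        ‖g (x, y₁, τ) - g (x, y₂, τ)‖ ≤ L * ‖y₁ - y₂‖

/-- The compact tubular neighbourhood K₀ of the slow limit x₀. -/
def slowTube {n : ℕ} (x0 : ℝ → EuclideanSpace ℝ (Fin n)) (t₀ r : ℝ) :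
    Set (EuclideanSpace ℝ (Fin n)) :=
  {z | ∃ t ∈ Set.Icc (0:ℝ) t₀, ∃ v : EuclideanSpace ℝ (Fin n), ‖v‖ ≤ r ∧ z = x0 t + v}

/-- The fiber A_{(h,x)}: initial values of bounded entire solutions of y' = h(x,y,τ). -/
def attrFiber {n m : ℕ} {H : Type*}
    (ev : H → C(EuclideanSpace ℝ (Fin n) × EuclideanSpace ℝ (Fin m) × ℝ,
      EuclideanSpace ℝ (Fin m)))
    (h : H) (x : EuclideanSpace ℝ (Fin n)) : Set (EuclideanSpace ℝ (Fin m)) :=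
  {z | ∃ y : ℝ → EuclideanSpace ℝ (Fin m), y 0 = z ∧ (∃ C, ∀ τ : ℝ, ‖y τ‖ ≤ C) ∧
    ∀ τ : ℝ, HasDerivAt y (ev h (x, y τ, τ)) τ}

/-- The parametrically inflated fiber A_{(h,x)}[δ] over the base H × K₀. -/
def inflFiber {n m : ℕ} {H : Type*} [MetricSpace H]
    (ev : H → C(EuclideanSpace ℝ (Fin n) × EuclideanSpace ℝ (Fin m) × ℝ,
      EuclideanSpace ℝ (Fin m)))
    (K₀ : Set (EuclideanSpace ℝ (Fin n)))
    (h : H) (x : EuclideanSpace ℝ (Fin n)) (δ : ℝ) : Set (EuclideanSpace ℝ (Fin m)) :=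
  ⋃ p ∈ {p : H × EuclideanSpace ℝ (Fin n) |
    p.2 ∈ K₀ ∧ max (dist h p.1) (dist x p.2) ≤ δ}, attrFiber ev p.1 p.2

/-- The inflated fiber Aˣ_h[δ] (inflation only in the hull variable). -/
def inflFiberH {n m : ℕ} {H : Type*} [MetricSpace H]
    (ev : H → C(EuclideanSpace ℝ (Fin n) × EuclideanSpace ℝ (Fin m) × ℝ,
      EuclideanSpace ℝ (Fin m)))
    (h : H) (x : EuclideanSpace ℝ (Fin n)) (δ : ℝ) : Set (EuclideanSpace ℝ (Fin m)) :=
  ⋃ h' ∈ {h' : H | dist h' h ≤ δ}, attrFiber ev h' x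

/-- The omega-limit set O(g₀) of g₀ for the flow σf. -/
def omegaSet {H : Type*} [TopologicalSpace H] (σf : ℝ → H → H) (g0 : H) : Set H :=
  ⋂ s ∈ Set.Ici (0:ℝ), closure {h : H | ∃ τ ≥ s, h = σf τ g0}

/-- The parametrically inflated fiber over the base O(g) × K₀. -/
def inflFiberO {n m : ℕ} {H : Type*} [MetricSpace H]
    (ev : H → C(EuclideanSpace ℝ (Fin n) × EuclideanSpace ℝ (Fin m) × ℝ,
      EuclideanSpace ℝ (Fin m)))
    (σf : ℝ → H → H) (g0 : H)
    (K₀ : Set (EuclideanSpace ℝ (Fin n)))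
    (h : H) (x : EuclideanSpace ℝ (Fin n)) (δ : ℝ) : Set (EuclideanSpace ℝ (Fin m)) :=
  ⋃ p ∈ {p : H × EuclideanSpace ℝ (Fin n) |
    p.1 ∈ omegaSet σf g0 ∧ p.2 ∈ K₀ ∧ max (dist h p.1) (dist x p.2) ≤ δ},
      attrFiber ev p.1 p.2

end

/-- Grönwall's estimate with a field that is Lipschitz only on a ball, for curves that start close
enough to each other not to leave that ball. -/
theorem dist_le_of_approx_trajectory_of_closedBall {E : Type*} [NormedAddCommGroup E]
    [NormedSpace ℝ E] {F : ℝ → E → E} {u v v' : ℝ → E} {T R δ η : ℝ} {L : NNReal}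
    (hL : ∀ t ∈ Ico 0 T, LipschitzOnWith L (F t) (closedBall 0 (R + 1)))
    (hu : ∀ t ∈ Icc 0 T, HasDerivAt u (F t (u t)) t)
    (hv : ∀ t ∈ Icc 0 T, HasDerivAt v (v' t) t)
    (huR : ∀ t ∈ Icc 0 T, ‖u t‖ ≤ R)
    (hvF : ∀ t ∈ Icc 0 T, ‖v t‖ ≤ R + 1 → dist (v' t) (F t (v t)) ≤ δ)
    (h0 : dist (v 0) (u 0) ≤ δ) (hδ : 0 ≤ δ)
    (hη : gronwallBound δ L δ T ≤ η) (hη1 : η < 1) :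
    ∀ t ∈ Icc 0 T, dist (v t) (u t) ≤ η := by
  have huc : ContinuousOn u (Icc 0 T) := fun t ht => (hu t ht).continuousAt.continuousWithinAt
  have hvc : ContinuousOn v (Icc 0 T) := fun t ht => (hv t ht).continuousAt.continuousWithinAt
  have hgron : ∀ b ∈ Icc 0 T, (∀ t ∈ Ico 0 b, dist (v t) (u t) < 1) →
      dist (v b) (u b) ≤ η := by
    intro b hb hlt
    have hsub : Icc 0 b ⊆ Icc 0 T := Icc_subset_Icc_right hb.2
    have hsub' : Ico 0 b ⊆ Icc 0 T := Ico_subset_Icc_self.trans hsub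
    have hball : ∀ t ∈ Ico 0 b, v t ∈ closedBall (0 : E) (R + 1) := by
      intro t ht
      rw [mem_closedBall_zero_iff]
      have h1 := hlt t ht
      rw [dist_eq_norm] at h1
      have h2 := norm_le_norm_add_norm_sub' (v t) (u t)
      linarith [huR t (hsub' ht)]
    have key := dist_le_of_approx_trajectories_ODE_of_mem (a := 0) (b := b)
      (f := v) (g := u) (f' := v') (g' := fun t => F t (u t)) (v := F) (εf := δ) (εg := 0)
      (s := fun _ => closedBall (0 : E) (R + 1)) (δ := δ) (K := L)
      (fun t ht => hL t ⟨ht.1, ht.2.trans_le hb.2⟩) (hvc.mono hsub)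
      (fun t ht => (hv t (hsub' ht)).hasDerivWithinAt)
      (fun t ht => hvF t (hsub' ht) (mem_closedBall_zero_iff.1 (hball t ht))) hball
      (huc.mono hsub) (fun t ht => (hu t (hsub' ht)).hasDerivWithinAt)
      (fun t _ => (dist_self _).le)
      (fun t ht => by
        rw [mem_closedBall_zero_iff]; linarith [huR t (hsub' ht)]) h0 b ⟨hb.1, le_rfl⟩
    rw [add_zero, sub_zero] at key
    exact (key.trans (gronwallBound_mono hδ hδ L.coe_nonneg hb.2)).trans hη
  have hlt : ∀ t ∈ Icc 0 T, dist (v t) (u t) < 1 := by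
    by_contra! hne
    let S := Icc 0 T ∩ (fun t => dist (v t) (u t)) ⁻¹' Ici 1
    have hS : IsCompact S := isCompact_Icc.of_isClosed_subset
      ((continuous_dist.comp_continuousOn (hvc.prodMk huc)).preimage_isClosed_of_isClosed
        isClosed_Icc isClosed_Ici) inter_subset_left
    obtain ⟨b, hbS, hbmin⟩ := hS.exists_isLeast (by
      obtain ⟨t, ht, h1⟩ := hne
      exact ⟨t, ht, h1⟩)
    have hle := hgron b hbS.1 fun t ht => by
      by_contra! h1
      exact absurd (hbmin ⟨⟨ht.1, ht.2.le.trans hbS.1.2⟩, h1⟩) (not_le.2 ht.2)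
    have h1 : (1 : ℝ) ≤ dist (v b) (u b) := hbS.2
    linarith
  exact fun b hb => hgron b hb fun t ht => hlt t ⟨ht.1, ht.2.le.trans hb.2⟩

theorem exists_pos_gronwallBound_le {L : ℝ} (hL : 0 < L) (T : ℝ) {η : ℝ} (hη : 0 < η) :
    ∃ δ > 0, gronwallBound δ L δ T ≤ η := by
  have hcont : Continuous fun δ => gronwallBound δ L δ T := by
    simp only [gronwallBound_of_K_ne_0 hL.ne']
    fun_prop
  have h0 : gronwallBound 0 L 0 T = 0 := gronwallBound_ε0_δ0 L T
  have hev : ∀ᶠ δ in 𝓝 (0 : ℝ), gronwallBound δ L δ T < η :=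
    hcont.continuousAt.eventually_lt continuousAt_const (by rwa [h0])
  obtain ⟨δ, hδ, hpos⟩ := ((hev.filter_mono nhdsWithin_le_nhds).and
    (self_mem_nhdsWithin : Ioi (0 : ℝ) ∈ 𝓝[>] 0)).exists
  exact ⟨δ, hpos, hδ.le⟩

/-- A compact family of vector fields `ev h`, closed under the time shifts `σf`, together with its
solutions `sol h x y₀`, started at time `0` and defined for all nonnegative times. -/
structure IsSolvedFamily {n m : ℕ} {H : Type*} [MetricSpace H] (σf : ℝ → H → H)
    (ev : H → C(EuclideanSpace ℝ (Fin n) × EuclideanSpace ℝ (Fin m) × ℝ,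
      EuclideanSpace ℝ (Fin m)))
    (sol : H → EuclideanSpace ℝ (Fin n) → EuclideanSpace ℝ (Fin m) → ℝ →
      EuclideanSpace ℝ (Fin m)) : Prop where
  continuous_flow : Continuous fun p : ℝ × H => σf p.1 p.2
  flow_add : ∀ s t h, σf (s + t) h = σf s (σf t h)
  continuous_ev : Continuous ev
  ev_flow : ∀ s h, ev (σf s h) = timeTranslate s (ev h)
  lipschitz : ∀ h, IsLipschitzInY (ev h)
  sol_zero : ∀ h x y₀, sol h x y₀ 0 = y₀
  hasDerivAt_sol : ∀ h x y₀ τ, 0 ≤ τ →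
    HasDerivAt (sol h x y₀) (ev h (x, sol h x y₀ τ, τ)) τ

/-- The solutions with parameters in `K` eventually enter the ball of radius `c`, uniformly. -/
def IsUltimateBound {n m : ℕ} {H : Type*}
    (sol : H → EuclideanSpace ℝ (Fin n) → EuclideanSpace ℝ (Fin m) → ℝ →
      EuclideanSpace ℝ (Fin m)) (K : Set (EuclideanSpace ℝ (Fin n))) (c : ℝ) : Prop :=
  ∀ d > 0, ∃ T > 0, ∀ h, ∀ x ∈ K, ∀ τ ≥ T, ∀ y₀, ‖y₀‖ ≤ d → ‖sol h x y₀ τ‖ ≤ c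

namespace IsSolvedFamily

variable {n m : ℕ} {H : Type*} [MetricSpace H] {σf : ℝ → H → H}
  {ev : H → C(EuclideanSpace ℝ (Fin n) × EuclideanSpace ℝ (Fin m) × ℝ,
    EuclideanSpace ℝ (Fin m))}
  {sol : H → EuclideanSpace ℝ (Fin n) → EuclideanSpace ℝ (Fin m) → ℝ →
    EuclideanSpace ℝ (Fin m)}

theorem ev_flow_apply (hS : IsSolvedFamily σf ev sol) (s : ℝ) (h : H)
    (x : EuclideanSpace ℝ (Fin n)) (y : EuclideanSpace ℝ (Fin m)) (τ : ℝ) :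
    ev (σf s h) (x, y, τ) = ev h (x, y, τ + s) := by
  rw [hS.ev_flow]; rfl

/-- On bounded time intervals solutions depend continuously on the vector field, on the initial
value, and on the parameter, which may be replaced by a nonconstant path. -/
theorem exists_dist_sol_le (hS : IsSolvedFamily σf ev sol) (h : H)
    (x : EuclideanSpace ℝ (Fin n)) (y₀ : EuclideanSpace ℝ (Fin m)) (T : ℝ) {η : ℝ} (hη : 0 < η) :
    ∃ δ > 0, ∀ h', dist h' h < δ → ∀ (X : ℝ → EuclideanSpace ℝ (Fin n))
      (v : ℝ → EuclideanSpace ℝ (Fin m)), ∀ T' ≤ T, dist (v 0) y₀ < δ →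
      (∀ s ∈ Icc 0 T', dist (X s) x < δ) →
      (∀ s ∈ Icc 0 T', HasDerivAt v (ev h' (X s, v s, s)) s) →
      ∀ s ∈ Icc 0 T', dist (v s) (sol h x y₀ s) ≤ η := by
  have huc : ContinuousOn (sol h x y₀) (Icc 0 T) := fun t ht =>
    (hS.hasDerivAt_sol h x y₀ t ht.1).continuousAt.continuousWithinAt
  obtain ⟨R, hR⟩ := isCompact_Icc.exists_bound_of_continuousOn huc
  obtain ⟨L, hL0, hL⟩ := hS.lipschitz h {x} isCompact_singleton
    (closedBall 0 (R + 1)) (isCompact_closedBall _ _)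
  obtain ⟨δ₀, hδ₀, hgron⟩ := exists_pos_gronwallBound_le hL0 (max T 0)
    (lt_min hη (one_half_pos (α := ℝ)))
  have hpert : ∀ᶠ q : H × EuclideanSpace ℝ (Fin n) in 𝓝 (h, x),
      ∀ p ∈ closedBall (0 : EuclideanSpace ℝ (Fin m)) (R + 1) ×ˢ Icc (0 : ℝ) T,
        dist (ev q.1 (q.2, p)) (ev h (x, p)) < δ₀ := by
    refine ((isCompact_closedBall _ _).prod
      isCompact_Icc).eventually_forall_of_forall_eventually fun p _ => ?_
    have hc : Continuous fun z : (H × EuclideanSpace ℝ (Fin n)) ×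
        (EuclideanSpace ℝ (Fin m) × ℝ) =>
        dist (ev z.1.1 (z.1.2, z.2)) (ev h (x, z.2)) := by
      have := hS.continuous_ev
      refine Continuous.dist ?_ (by fun_prop)
      exact (this.comp (continuous_fst.comp continuous_fst)).eval (by fun_prop)
    exact hc.continuousAt.eventually_lt continuousAt_const (by simpa using hδ₀)
  obtain ⟨δ₁, hδ₁, hball⟩ := Metric.eventually_nhds_iff.1 hpert
  refine ⟨min δ₀ δ₁, lt_min hδ₀ hδ₁, fun h' hh' X v T' hT' hv0 hX hv s hs => ?_⟩
  have hsub : ∀ t ∈ Icc 0 T', t ∈ Icc 0 T := fun t ht => ⟨ht.1, ht.2.trans hT'⟩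
  have hT0 : T' ≤ max T 0 := hT'.trans (le_max_left _ _)
  refine (dist_le_of_approx_trajectory_of_closedBall (F := fun t y => ev h (x, y, t))
    (u := sol h x y₀) (v := v) (v' := fun t => ev h' (X t, v t, t)) (T := T') (R := R)
    (δ := δ₀) (L := ⟨L, hL0.le⟩) ?_ (fun t ht => hS.hasDerivAt_sol h x y₀ t ht.1) hv
    (fun t ht => hR t (hsub t ht)) ?_ ?_ hδ₀.le
    ((gronwallBound_mono hδ₀.le hδ₀.le hL0.le hT0).trans hgron)
    ((min_le_right _ _).trans_lt one_half_lt_one) s hs).trans (min_le_left _ _)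
  · intro t _
    refine LipschitzOnWith.of_dist_le_mul fun y₁ h₁ y₂ h₂ => ?_
    rw [dist_eq_norm, dist_eq_norm]
    exact hL x rfl y₁ h₁ y₂ h₂ t
  · intro t ht hvt
    refine (hball (y := (h', X t)) ?_ (v t, t) ⟨mem_closedBall_zero_iff.2 hvt, hsub t ht⟩).le
    exact max_lt (hh'.trans_le (min_le_right _ _)) ((hX t ht).trans_le (min_le_right _ _))
  · rw [hS.sol_zero]
    exact hv0.le.trans (min_le_left _ _)

theorem eq_sol (hS : IsSolvedFamily σf ev sol) {h : H} {x : EuclideanSpace ℝ (Fin n)}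
    {v : ℝ → EuclideanSpace ℝ (Fin m)} {T : ℝ}
    (hv : ∀ s ∈ Icc 0 T, HasDerivAt v (ev h (x, v s, s)) s) :
    ∀ s ∈ Icc 0 T, v s = sol h x (v 0) s := by
  intro s hs
  refine eq_of_forall_dist_le fun η hη => ?_
  obtain ⟨δ, hδ, H⟩ := hS.exists_dist_sol_le h x (v 0) T hη
  exact H h (by simpa using hδ) (fun _ => x) v T le_rfl (by simpa using hδ)
    (fun _ _ => by simpa using hδ) hv s hs

theorem hasDerivAt_shift (hS : IsSolvedFamily σf ev sol) {h : H}
    {X : ℝ → EuclideanSpace ℝ (Fin n)} {v : ℝ → EuclideanSpace ℝ (Fin m)} {a s : ℝ}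
    (hv : HasDerivAt v (ev h (X (s + a), v (s + a), s + a)) (s + a)) :
    HasDerivAt (fun t => v (t + a)) (ev (σf a h) (X (s + a), v (s + a), s)) s := by
  rw [hS.ev_flow_apply]
  exact hv.comp_add_const s a

/-- The cocycle property. -/
theorem sol_add (hS : IsSolvedFamily σf ev sol) (h : H) (x : EuclideanSpace ℝ (Fin n))
    (y₀ : EuclideanSpace ℝ (Fin m)) {s t : ℝ} (hs : 0 ≤ s) (ht : 0 ≤ t) :
    sol h x y₀ (s + t) = sol (σf t h) x (sol h x y₀ t) s := by
  have := hS.eq_sol (h := σf t h) (x := x) (v := fun s => sol h x y₀ (s + t)) (T := s)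
    (fun r hr => hS.hasDerivAt_shift (X := fun _ => x)
      (hS.hasDerivAt_sol h x y₀ _ (add_nonneg hr.1 ht))) s ⟨hs, le_rfl⟩
  simpa using this

/-- An ultimate bound along a dense family of translates is an ultimate bound for the family. -/
theorem isUltimateBound (hS : IsSolvedFamily σf ev sol) {g₀ : H}
    (hdense : DenseRange fun s => σf s g₀) {K : Set (EuclideanSpace ℝ (Fin n))} {c : ℝ}
    (hc : ∀ d > 0, ∃ T > 0, ∀ s, ∀ x ∈ K, ∀ τ ≥ T, ∀ y₀, ‖y₀‖ ≤ d →
      ‖sol (σf s g₀) x y₀ τ‖ ≤ c) : IsUltimateBound sol K c := by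
  intro d hd
  obtain ⟨T, hT, hb⟩ := hc d hd
  refine ⟨T, hT, fun h x hx τ hτ y₀ hy₀ => le_of_forall_pos_le_add fun η hη => ?_⟩
  obtain ⟨δ, hδ, hclose⟩ := hS.exists_dist_sol_le h x y₀ τ hη
  obtain ⟨s, hs⟩ := hdense.exists_dist_lt h hδ
  have hτ0 : 0 ≤ τ := hT.le.trans hτ
  have hd := hclose (σf s g₀) (by rwa [dist_comm]) (fun _ => x) (sol (σf s g₀) x y₀) τ le_rfl
    (by rw [hS.sol_zero]; simpa using hδ) (fun _ _ => by simpa using hδ)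
    (fun r hr => hS.hasDerivAt_sol _ _ _ _ hr.1) τ ⟨hτ0, le_rfl⟩
  rw [dist_comm, dist_eq_norm] at hd
  have h2 := norm_le_norm_add_norm_sub' (sol h x y₀ τ) (sol (σf s g₀) x y₀ τ)
  linarith [hb s x hx τ hτ y₀ hy₀]

theorem norm_le_of_mem_attrFiber (hS : IsSolvedFamily σf ev sol)
    {K : Set (EuclideanSpace ℝ (Fin n))} {c : ℝ} (hc : IsUltimateBound sol K c) {h : H}
    {x : EuclideanSpace ℝ (Fin n)} (hx : x ∈ K) {z : EuclideanSpace ℝ (Fin m)}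
    (hz : z ∈ attrFiber ev h x) : ‖z‖ ≤ c := by
  obtain ⟨y, rfl, ⟨C, hC⟩, hy⟩ := hz
  obtain ⟨T, hT, hb⟩ := hc (max C 1) (by positivity)
  have heq := hS.eq_sol (h := σf (-T) h) (x := x) (v := fun s => y (s + -T)) (T := T)
    (fun s _ => hS.hasDerivAt_shift (X := fun _ => x) (hy _)) T ⟨hT.le, le_rfl⟩
  simp only [add_neg_cancel] at heq
  rw [heq]
  exact hb _ x hx T le_rfl _ ((hC _).trans (le_max_left _ _))

/-- A bounded backward orbit along the integers extends to a bounded entire solution. -/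
theorem mem_attrFiber_of_backward_orbit (hS : IsSolvedFamily σf ev sol)
    {K : Set (EuclideanSpace ℝ (Fin n))} {c : ℝ} (hc : IsUltimateBound sol K c) {h : H}
    {x : EuclideanSpace ℝ (Fin n)} (hx : x ∈ K) {w : ℕ → EuclideanSpace ℝ (Fin m)} {R : ℝ}
    (hwR : ∀ j, ‖w j‖ ≤ R)
    (hw : ∀ j : ℕ, sol (σf (-(j + 1 : ℝ)) h) x (w (j + 1)) 1 = w j) :
    w 0 ∈ attrFiber ev h x := by
  let u : ℕ → ℝ → EuclideanSpace ℝ (Fin m) := fun j t => sol (σf (-(j : ℝ)) h) x (w j) (t + j)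
  have hsucc : ∀ (j : ℕ) (t : ℝ), -(j : ℝ) ≤ t → u (j + 1) t = u j t := by
    intro j t ht
    have h1 := hS.sol_add (σf (-(j + 1 : ℝ)) h) x (w (j + 1)) (s := t + j) (t := 1)
      (by linarith) zero_le_one
    rw [hw, ← hS.flow_add] at h1
    simp only [u, Nat.cast_add, Nat.cast_one]
    rw [← add_assoc, h1]
    congr 2
    ring
  have hle : ∀ (i j : ℕ), i ≤ j → ∀ t : ℝ, -(i : ℝ) ≤ t → u j t = u i t := by
    intro i j hij t ht
    induction j, hij using Nat.le_induction with
    | base => rfl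
    | succ j hij ih =>
      rw [hsucc j t (le_trans (neg_le_neg (by exact_mod_cast hij)) ht), ih]
  let N : ℝ → ℕ := fun t => ⌈|t|⌉₊ + 1
  have hN : ∀ t : ℝ, -(N t : ℝ) + 1 ≤ t := by
    intro t
    have := Nat.le_ceil |t|
    have := neg_abs_le t
    simp only [N, Nat.cast_add, Nat.cast_one]
    linarith
  have hNu : ∀ (j : ℕ) (t : ℝ), -(j : ℝ) ≤ t → u (N t) t = u j t := by
    intro j t ht
    rcases le_total j (N t) with hj | hj
    · exact hle _ _ hj t ht
    · exact (hle _ _ hj t (by linarith [hN t])).symm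
  have hderiv : ∀ (j : ℕ) (t : ℝ), -(j : ℝ) ≤ t → HasDerivAt (u j) (ev h (x, u j t, t)) t := by
    intro j t ht
    have h1 := (hS.hasDerivAt_sol (σf (-(j : ℝ)) h) x (w j) (t + j)
      (by linarith)).comp_add_const t (j : ℝ)
    rw [hS.ev_flow_apply, add_neg_cancel_right] at h1
    exact h1
  refine ⟨fun t => u (N t) t, ?_, ⟨c, fun t => ?_⟩, fun t => ?_⟩
  · change u (N 0) 0 = w 0
    rw [hNu 0 0 (by simp)]
    simp [u, hS.sol_zero]
  · obtain ⟨T, hT, hb⟩ := hc (max R 1) (by positivity)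
    obtain ⟨j, hj⟩ := exists_nat_ge (T - t)
    change ‖u (N t) t‖ ≤ c
    rw [hNu j t (by linarith)]
    exact hb _ x hx _ (by linarith) _ ((hwR j).trans (le_max_left _ _))
  · refine (hderiv (N t) t (by linarith [hN t])).congr_of_eventuallyEq ?_
    filter_upwards [Ioi_mem_nhds (show t - 1 < t by linarith)] with s hs
    exact hNu (N t) s (by linarith [hN t, mem_Ioi.1 hs])

/-- Over one time step, solutions along an almost constant parameter path are uniformly bounded,
and end close to the ultimate bound. -/
theorem exists_bound_of_almost_constant_parameter [CompactSpace H]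
    (hS : IsSolvedFamily σf ev sol) {K : Set (EuclideanSpace ℝ (Fin n))} (hK : IsCompact K)
    {c : ℝ} (hc : IsUltimateBound sol K c) {d : ℝ} (hd : 0 < d) :
    ∃ T > 0, ∃ δ > 0, ∃ R, ∀ h, ∀ x ∈ K, ∀ (X : ℝ → EuclideanSpace ℝ (Fin n))
      (v : ℝ → EuclideanSpace ℝ (Fin m)), ∀ T' ≤ T, ‖v 0‖ ≤ d →
      (∀ s ∈ Icc 0 T', dist (X s) x < δ) →
      (∀ s ∈ Icc 0 T', HasDerivAt v (ev h (X s, v s, s)) s) →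
      (∀ s ∈ Icc 0 T', ‖v s‖ ≤ R) ∧ (T' = T → ‖v T‖ ≤ c + 1) := by
  obtain ⟨T, hT, hb⟩ := hc d hd
  refine ⟨T, hT, ?_⟩
  let P : Set (H × EuclideanSpace ℝ (Fin n) × EuclideanSpace ℝ (Fin m)) → Prop := fun S =>
    ∃ δ > 0, ∃ R, ∀ p ∈ S, ∀ (X : ℝ → EuclideanSpace ℝ (Fin n))
      (v : ℝ → EuclideanSpace ℝ (Fin m)), ∀ T' ≤ T, v 0 = p.2.2 →
      (∀ s ∈ Icc 0 T', dist (X s) p.2.1 < δ) →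
      (∀ s ∈ Icc 0 T', HasDerivAt v (ev p.1 (X s, v s, s)) s) →
      (∀ s ∈ Icc 0 T', ‖v s‖ ≤ R) ∧ (T' = T → ‖v T‖ ≤ c + 1)
  have hcompact : IsCompact ((univ : Set H) ×ˢ K ×ˢ
      closedBall (0 : EuclideanSpace ℝ (Fin m)) d) :=
    isCompact_univ.prod (hK.prod (isCompact_closedBall _ _))
  have hP : P ((univ : Set H) ×ˢ K ×ˢ closedBall (0 : EuclideanSpace ℝ (Fin m)) d) := by
    refine hcompact.induction_on ⟨1, one_pos, 0, fun p hp => hp.elim⟩ ?_ ?_ ?_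
    · rintro s t hst ⟨δ, hδ, R, h⟩
      exact ⟨δ, hδ, R, fun p hp => h p (hst hp)⟩
    · rintro s t ⟨δ₁, hδ₁, R₁, h₁⟩ ⟨δ₂, hδ₂, R₂, h₂⟩
      refine ⟨min δ₁ δ₂, lt_min hδ₁ hδ₂, max R₁ R₂, ?_⟩
      rintro p (hp | hp) X v T' hT' hv0 hX hv
      · have := h₁ p hp X v T' hT' hv0 (fun s hs => (hX s hs).trans_le (min_le_left _ _)) hv
        exact ⟨fun s hs => (this.1 s hs).trans (le_max_left _ _), this.2⟩
      · have := h₂ p hp X v T' hT' hv0 (fun s hs => (hX s hs).trans_le (min_le_right _ _)) hv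
        exact ⟨fun s hs => (this.1 s hs).trans (le_max_right _ _), this.2⟩
    · rintro ⟨h, x, y₀⟩ ⟨-, hx, hy₀⟩
      obtain ⟨δ, hδ, hclose⟩ := hS.exists_dist_sol_le h x y₀ T one_pos
      obtain ⟨R, hR⟩ := isCompact_Icc.exists_bound_of_continuousOn (s := Icc 0 T)
        (f := sol h x y₀)
        (fun t ht => (hS.hasDerivAt_sol h x y₀ t ht.1).continuousAt.continuousWithinAt)
      refine ⟨ball (h, x, y₀) (δ / 2), mem_nhdsWithin_of_mem_nhds (ball_mem_nhds _ (half_pos hδ)),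
        δ / 2, half_pos hδ, R + 1, ?_⟩
      rintro ⟨h', x', y'⟩ hp X v T' hT' hv0 hX hv
      simp only [mem_ball, Prod.dist_eq, sup_lt_iff] at hp
      have key := hclose h' (by linarith) X v T' hT' (by rw [hv0]; linarith)
        (fun s hs => by linarith [dist_triangle (X s) x' x, hX s hs]) hv
      have hnorm : ∀ s ∈ Icc 0 T', ‖v s‖ ≤ ‖sol h x y₀ s‖ + 1 := fun s hs => by
        have h1 := key s hs
        rw [dist_eq_norm] at h1
        linarith [norm_le_norm_add_norm_sub' (v s) (sol h x y₀ s)]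
      refine ⟨fun s hs => ?_, ?_⟩
      · linarith [hnorm s hs, hR s ⟨hs.1, hs.2.trans hT'⟩]
      · rintro rfl
        linarith [hnorm T' ⟨hT.le, le_rfl⟩,
          hb h x hx T' le_rfl y₀ (mem_closedBall_zero_iff.1 hy₀)]
  obtain ⟨δ, hδ, R, hPR⟩ := hP
  exact ⟨δ, hδ, R, fun h x hx X v T' hT' hv0 hX hv =>
    hPR (h, x, v 0) ⟨mem_univ _, hx, mem_closedBall_zero_iff.2 hv0⟩ X v T' hT' rfl hX hv⟩

/-- Solutions along slowly varying parameter paths are bounded, uniformly in the length of the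
time interval. -/
theorem exists_bound_of_slow_parameter [CompactSpace H]
    (hS : IsSolvedFamily σf ev sol) {K : Set (EuclideanSpace ℝ (Fin n))} (hK : IsCompact K)
    {c : ℝ} (hc : IsUltimateBound sol K c) (d : ℝ) :
    ∃ T > 0, ∃ δ > 0, ∃ R, ∀ h (X : ℝ → EuclideanSpace ℝ (Fin n))
      (v : ℝ → EuclideanSpace ℝ (Fin m)) (b : ℝ), ‖v 0‖ ≤ d →
      (∀ s ∈ Icc 0 b, X s ∈ K) →
      (∀ s ∈ Icc 0 b, ∀ t ∈ Icc 0 b, |s - t| ≤ T → dist (X s) (X t) < δ) →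
      (∀ s ∈ Icc 0 b, HasDerivAt v (ev h (X s, v s, s)) s) →
      ∀ s ∈ Icc 0 b, ‖v s‖ ≤ R := by
  obtain ⟨T, hT, δ, hδ, R, hR⟩ := hS.exists_bound_of_almost_constant_parameter hK hc
    (d := max (max d (c + 1)) 1) (by positivity)
  refine ⟨T, hT, δ, hδ, R, fun h X v b hv0 hX hslow hv s hs => ?_⟩
  have hstep : ∀ r ∈ Icc 0 b, ‖v r‖ ≤ max (max d (c + 1)) 1 → ∀ T' ≤ T, r + T' ≤ b →
      (∀ s ∈ Icc 0 T', ‖v (s + r)‖ ≤ R) ∧ (T' = T → ‖v (T + r)‖ ≤ c + 1) := by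
    intro r hr hvr T' hT' hb
    have hmem : ∀ s ∈ Icc 0 T', s + r ∈ Icc 0 b := fun s hs =>
      ⟨add_nonneg hs.1 hr.1, by linarith [hs.2]⟩
    refine hR (σf r h) (X r) (hX r hr) (fun s => X (s + r)) (fun s => v (s + r)) T' hT'
      (by simpa using hvr) (fun s hs => hslow _ (hmem s hs) r hr ?_)
      (fun s hs => hS.hasDerivAt_shift (hv _ (hmem s hs)))
    rw [add_sub_cancel_right, abs_of_nonneg hs.1]
    exact hs.2.trans hT'
  have hgrid : ∀ j : ℕ, j * T ≤ b → ‖v (j * T)‖ ≤ max (max d (c + 1)) 1 := by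
    intro j
    induction j with
    | zero => intro _; simpa using Or.inl (Or.inl hv0)
    | succ j ih =>
      intro hj
      push_cast at hj ⊢
      have hj' : j * T ≤ b := by nlinarith
      have := (hstep (j * T) ⟨by positivity, hj'⟩ (ih hj') T le_rfl (by linarith)).2 rfl
      rw [show (j + 1 : ℝ) * T = T + j * T by ring]
      exact this.trans ((le_max_right _ _).trans (le_max_left _ _))
  have hfloor : ⌊s / T⌋₊ * T ≤ s := by
    rw [← le_div_iff₀ hT]
    exact Nat.floor_le (div_nonneg hs.1 hT.le)
  have hfloor' : s < (⌊s / T⌋₊ + 1) * T := by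
    rw [← div_lt_iff₀ hT]
    exact Nat.lt_floor_add_one _
  have := (hstep (⌊s / T⌋₊ * T) ⟨by positivity, hfloor.trans hs.2⟩ (hgrid _ (hfloor.trans hs.2))
    (s - ⌊s / T⌋₊ * T) (by linarith) (by linarith [hs.2])).1 (s - ⌊s / T⌋₊ * T)
    ⟨by linarith, le_rfl⟩
  rwa [sub_add_cancel] at this

/-- If the parameter paths converge on final time segments of arbitrary length, the end values of
bounded solutions on longer and longer intervals converge into the limiting fiber. -/
theorem exists_mem_attrFiber_tendsto (hS : IsSolvedFamily σf ev sol)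
    {K : Set (EuclideanSpace ℝ (Fin n))} {c : ℝ} (hc : IsUltimateBound sol K c) {ι : Type*}
    (𝒰 : Ultrafilter ι) {τ : ι → ℝ} {X : ι → ℝ → EuclideanSpace ℝ (Fin n)}
    {v : ι → ℝ → EuclideanSpace ℝ (Fin m)} {g₀ h : H} {x : EuclideanSpace ℝ (Fin n)} {R : ℝ}
    (hx : x ∈ K) (hτ : Tendsto τ 𝒰 atTop) (hh : Tendsto (fun k => σf (τ k) g₀) 𝒰 (𝓝 h))
    (hX : ∀ T, ∀ δ > 0, ∀ᶠ k in 𝒰, ∀ s ∈ Icc (τ k - T) (τ k), dist (X k s) x < δ)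
    (hv : ∀ᶠ k in 𝒰, ∀ s ∈ Icc 0 (τ k), HasDerivAt (v k) (ev g₀ (X k s, v k s, s)) s)
    (hR : ∀ᶠ k in 𝒰, ∀ s ∈ Icc 0 (τ k), ‖v k s‖ ≤ R) :
    ∃ z ∈ attrFiber ev h x, Tendsto (fun k => v k (τ k)) 𝒰 (𝓝 z) := by
  have hlim : ∀ j : ℕ, ∃ z : EuclideanSpace ℝ (Fin m), ‖z‖ ≤ R ∧
      Tendsto (fun k => v k (τ k - j)) 𝒰 (𝓝 z) := by
    intro j
    have hmem : ∀ᶠ k in 𝒰, v k (τ k - j) ∈ closedBall (0 : EuclideanSpace ℝ (Fin m)) R := by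
      filter_upwards [hR, hτ.eventually_ge_atTop (j : ℝ)] with k hk hj
      exact mem_closedBall_zero_iff.2 (hk _ ⟨by linarith, by simp⟩)
    obtain ⟨z, hz, hle⟩ := (isCompact_closedBall _ R).ultrafilter_le_nhds'
      (𝒰.map fun k => v k (τ k - j)) hmem
    exact ⟨z, mem_closedBall_zero_iff.1 hz, hle⟩
  choose w hwR hw using hlim
  refine ⟨w 0, hS.mem_attrFiber_of_backward_orbit hc hx hwR fun j => ?_, by simpa using hw 0⟩
  refine tendsto_nhds_unique (tendsto_iff_dist_tendsto_zero.2 ?_) (hw j)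
  refine Metric.tendsto_nhds.2 fun η hη => ?_
  obtain ⟨δ, hδ, hclose⟩ := hS.exists_dist_sol_le (σf (-(j + 1 : ℝ)) h) x (w (j + 1)) 1
    (half_pos hη)
  have hh' : Tendsto (fun k => σf (-(j + 1 : ℝ)) (σf (τ k) g₀)) 𝒰
      (𝓝 (σf (-(j + 1 : ℝ)) h)) :=
    ((hS.continuous_flow.comp (Continuous.prodMk_right (-(j + 1 : ℝ)))).tendsto h).comp hh
  filter_upwards [hv, hτ.eventually_ge_atTop (j + 1 : ℝ), hX (j + 1) δ hδ,
    Metric.tendsto_nhds.1 hh' δ hδ, Metric.tendsto_nhds.1 (hw (j + 1)) δ hδ]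
    with k hvk hτk hXk hhk hwk
  rw [← hS.flow_add, neg_add_eq_sub] at hhk
  push_cast at hwk
  have hj : (0 : ℝ) ≤ j := j.cast_nonneg
  have := hclose _ hhk (fun s => X k (s + (τ k - (j + 1)))) (fun s => v k (s + (τ k - (j + 1)))) 1
    le_rfl (by simpa using hwk)
    (fun s hs => hXk _ ⟨by linarith [hs.1], by linarith [hs.2]⟩)
    (fun s hs => hS.hasDerivAt_shift (hvk _ ⟨by linarith [hs.1], by linarith [hs.2]⟩))
    1 ⟨zero_le_one, le_rfl⟩
  rw [show (1 : ℝ) + (τ k - (j + 1)) = τ k - j by ring] at this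
  rw [Real.dist_eq, sub_zero, abs_of_nonneg dist_nonneg]
  linarith

end IsSolvedFamily

theorem isLipschitzInY_of_mem_closure_translates {n m : ℕ}
    {g h : C(EuclideanSpace ℝ (Fin n) × EuclideanSpace ℝ (Fin m) × ℝ, EuclideanSpace ℝ (Fin m))}
    (hg : IsLipschitzInY g) (hh : h ∈ closure {h | ∃ s : ℝ, h = timeTranslate s g}) :
    IsLipschitzInY h := by
  intro K₀ hK₀ K hK
  obtain ⟨L, hL0, hL⟩ := hg K₀ hK₀ K hK
  refine ⟨L, hL0, fun x hx y₁ h₁ y₂ h₂ τ => ?_⟩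
  have hclosed : IsClosed {h : C(EuclideanSpace ℝ (Fin n) × EuclideanSpace ℝ (Fin m) × ℝ,
      EuclideanSpace ℝ (Fin m)) | ‖h (x, y₁, τ) - h (x, y₂, τ)‖ ≤ L * ‖y₁ - y₂‖} :=
    isClosed_le (by fun_prop) continuous_const
  refine closure_minimal ?_ hclosed hh
  rintro _ ⟨s, rfl⟩
  exact hL x hx y₁ h₁ y₂ h₂ (τ + s)

theorem denseRange_flow {n m : ℕ} {H : Type*} [TopologicalSpace H] {σf : ℝ → H → H}
    {ev : H → C(EuclideanSpace ℝ (Fin n) × EuclideanSpace ℝ (Fin m) × ℝ,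
      EuclideanSpace ℝ (Fin m))} (hev : Topology.IsEmbedding ev) {g₀ : H}
    (hrange : Set.range ev = closure {h | ∃ s : ℝ, h = timeTranslate s (ev g₀)})
    (hequiv : ∀ s h, ev (σf s h) = timeTranslate s (ev h)) :
    DenseRange fun s => σf s g₀ := by
  rw [DenseRange, hev.isInducing.dense_iff]
  intro h
  have hmem : ev h ∈ closure {h | ∃ s : ℝ, h = timeTranslate s (ev g₀)} :=
    hrange ▸ mem_range_self h
  refine closure_mono ?_ hmem
  rintro _ ⟨s, rfl⟩
  exact ⟨σf s g₀, mem_range_self s, hequiv s g₀⟩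

/-- under continuity of (h,x) ↦ A_{(h,x)}, the fast final values approach the fiber at (g·(t₀/ε_k), x₀(t₀)). -/
theorem stmt_15
    {n m : ℕ} (hn : 1 ≤ n) (hm : 1 ≤ m)
    -- g, admissible and Lipschitz in y on compacts
    (g : C(EuclideanSpace ℝ (Fin n) × EuclideanSpace ℝ (Fin m) × ℝ,
      EuclideanSpace ℝ (Fin m)))
    (hadm : IsAdmissibleMap g) (hlip : IsLipschitzInY g)
    -- the hull H of g, a compact metric space with the continuous shift flow,
    -- identified via the embedding ev with the closure of the translates of g
    (H : Type) [MetricSpace H] [CompactSpace H]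
    (σf : ℝ → H → H)
    (hσcont : Continuous fun p : ℝ × H => σf p.1 p.2)
    (hσ0 : ∀ h, σf 0 h = h)
    (hσadd : ∀ s t : ℝ, ∀ h, σf (s + t) h = σf s (σf t h))
    (ev : H → C(EuclideanSpace ℝ (Fin n) × EuclideanSpace ℝ (Fin m) × ℝ,
      EuclideanSpace ℝ (Fin m)))
    (hev : Topology.IsEmbedding ev)
    (hrange : Set.range ev = closure {h | ∃ s : ℝ, h = timeTranslate s g})
    (g0 : H) (hg0 : ev g0 = g)
    (hequiv : ∀ (s : ℝ) (h : H), ev (σf s h) = timeTranslate s (ev h))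
    -- the (unique, maximal) solutions y(τ,h,x,τ₀,y₀) of y' = h(x,y,τ)
    (sol : H → EuclideanSpace ℝ (Fin n) → ℝ → EuclideanSpace ℝ (Fin m) → ℝ →
      EuclideanSpace ℝ (Fin m))
    (hsolinit : ∀ h x τ₀ y₀, sol h x τ₀ y₀ τ₀ = y₀)
    -- (H1): all solutions over the hull are globally defined in the future
    (hsolode : ∀ h x (τ₀ : ℝ) y₀ (τ : ℝ), τ₀ ≤ τ →
      HasDerivAt (sol h x τ₀ y₀) (ev h (x, sol h x τ₀ y₀ τ, τ)) τ)
    -- (H2): uniform ultimate boundedness over compact sets of parameters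
    (hH2 : ∀ K₀ : Set (EuclideanSpace ℝ (Fin n)), IsCompact K₀ →
      ∃ c > (0:ℝ), ∀ d > (0:ℝ), ∃ T > (0:ℝ), ∀ x ∈ K₀, ∀ τ₀ : ℝ, ∀ τ ≥ T,
        ∀ y₀ : EuclideanSpace ℝ (Fin m), ‖y₀‖ ≤ d → ‖sol g0 x τ₀ y₀ (τ + τ₀)‖ ≤ c)
    -- the slow vector field f, continuous and of linear growth
    (f : EuclideanSpace ℝ (Fin n) → EuclideanSpace ℝ (Fin m) → EuclideanSpace ℝ (Fin n))
    (hf : Continuous fun p : EuclideanSpace ℝ (Fin n) × EuclideanSpace ℝ (Fin m) =>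
      f p.1 p.2)
    (a b : ℝ) (ha : 0 < a) (hb : 0 < b)
    (hgrowth : ∀ x y, ‖f x y‖ ≤ a + b * ‖x‖)
    -- initial data, final slow time, the sequence ε_k ↓ 0, and the solutions
    -- (x_{ε_k}, y_{ε_k}) of the slow-fast system in the fast time
    (xInit : EuclideanSpace ℝ (Fin n)) (yInit : EuclideanSpace ℝ (Fin m))
    (t₀ : ℝ) (ht₀ : 0 < t₀)
    (ε : ℕ → ℝ) (hεpos : ∀ k, 0 < ε k) (hεanti : StrictAnti ε)
    (hεlim : Tendsto ε atTop (𝓝 0))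
    (xe : ℕ → ℝ → EuclideanSpace ℝ (Fin n)) (ye : ℕ → ℝ → EuclideanSpace ℝ (Fin m))
    (hxe0 : ∀ k, xe k 0 = xInit) (hye0 : ∀ k, ye k 0 = yInit)
    (hxeode : ∀ k : ℕ, ∀ τ ∈ Set.Icc (0:ℝ) (t₀ / ε k),
      HasDerivAt (xe k) (ε k • f (xe k τ) (ye k τ)) τ)
    (hyeode : ∀ k : ℕ, ∀ τ ∈ Set.Icc (0:ℝ) (t₀ / ε k),
      HasDerivAt (ye k) (g (xe k τ, ye k τ, τ)) τ)
    -- the slow components converge uniformly (in the slow time) to x₀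
    (x0 : ℝ → EuclideanSpace ℝ (Fin n)) (hx0cont : ContinuousOn x0 (Set.Icc 0 t₀))
    (hconv : TendstoUniformlyOn (fun k t => xe k (t / ε k)) x0 atTop (Set.Icc 0 t₀))
    -- the radius of the compact tube K₀ around x₀
    (r : ℝ) (hr : 0 < r)
    -- continuity of (h,x) ↦ A_{(h,x)} for the Hausdorff distance
    (hcont : ∀ p : H × EuclideanSpace ℝ (Fin n), p.2 ∈ slowTube x0 t₀ r →
      Tendsto (fun q : H × EuclideanSpace ℝ (Fin n) =>
          Metric.hausdorffDist (attrFiber ev q.1 q.2) (attrFiber ev p.1 p.2))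
        (𝓝[{q : H × EuclideanSpace ℝ (Fin n) | q.2 ∈ slowTube x0 t₀ r}] p) (𝓝 0))
 :
    Tendsto (fun k : ℕ => Metric.infDist (ye k (t₀ / ε k))
        (attrFiber ev (σf (t₀ / ε k) g0) (x0 t₀))) atTop (𝓝 0) := by
  have hS : IsSolvedFamily σf ev fun h x y₀ => sol h x 0 y₀ :=
    { continuous_flow := hσcont
      flow_add := hσadd
      continuous_ev := hev.continuous
      ev_flow := hequiv
      lipschitz := fun h =>
        isLipschitzInY_of_mem_closure_translates hlip (hrange ▸ mem_range_self h)
      sol_zero := fun h x y₀ => hsolinit h x 0 y₀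
      hasDerivAt_sol := fun h x y₀ τ hτ => hsolode h x 0 y₀ τ hτ }
  have hdense : DenseRange fun s => σf s g0 := denseRange_flow hev (by rw [hg0, hrange]) hequiv
  have hτpos : ∀ k, 0 < t₀ / ε k := fun k => div_pos ht₀ (hεpos k)
  have hτlim : Tendsto (fun k => t₀ / ε k) atTop atTop :=
    (tendsto_inv_nhdsGT_zero.comp (tendsto_nhdsWithin_iff.2
      ⟨hεlim, .of_forall hεpos⟩)).const_mul_atTop ht₀
  have hslowtime : ∀ k, ∀ s ∈ Icc 0 (t₀ / ε k), s * ε k ∈ Icc 0 t₀ ∧ s * ε k / ε k = s :=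
    fun k s hs => ⟨⟨mul_nonneg hs.1 (hεpos k).le, (le_div_iff₀ (hεpos k)).1 hs.2⟩,
      mul_div_cancel_right₀ s (hεpos k).ne'⟩
  have ht₀mem : t₀ ∈ Icc 0 t₀ := ⟨ht₀.le, le_rfl⟩
  -- the slow components stay in a common ball
  obtain ⟨M, hM⟩ := isCompact_Icc.exists_bound_of_continuousOn hx0cont
  have hM0 : 0 ≤ M := (norm_nonneg _).trans (hM t₀ ht₀mem)
  let K : Set (EuclideanSpace ℝ (Fin n)) := closedBall 0 (M + 1)
  have hK : IsCompact K := isCompact_closedBall _ _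
  have hxK : x0 t₀ ∈ K := mem_closedBall_zero_iff.2 (by linarith [hM t₀ ht₀mem])
  have hxeK : ∀ᶠ k in atTop, ∀ s ∈ Icc 0 (t₀ / ε k), xe k s ∈ K := by
    filter_upwards [Metric.tendstoUniformlyOn_iff.1 hconv 1 one_pos] with k hk s hs
    obtain ⟨hmem, heq⟩ := hslowtime k s hs
    have h1 := hk _ hmem
    rw [heq, dist_comm, dist_eq_norm] at h1
    refine mem_closedBall_zero_iff.2 ?_
    linarith [norm_le_norm_add_norm_sub' (xe k s) (x0 (s * ε k)), hM _ hmem]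
  -- and are slow
  let B : ℝ := a + b * (M + 1)
  have hB : 0 < B := by positivity
  have hspeed : ∀ᶠ k in atTop, ∀ s ∈ Icc 0 (t₀ / ε k), ∀ t ∈ Icc 0 (t₀ / ε k),
      dist (xe k s) (xe k t) ≤ ε k * B * |s - t| := by
    filter_upwards [hxeK] with k hk s hs t ht
    rw [dist_eq_norm]
    refine (convex_Icc (0 : ℝ) (t₀ / ε k)).norm_image_sub_le_of_norm_hasDerivWithin_le
      (fun r hr => (hxeode k r hr).hasDerivWithinAt) (fun r hr => ?_) ht hs
    rw [norm_smul, Real.norm_of_nonneg (hεpos k).le]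
    refine mul_le_mul_of_nonneg_left ((hgrowth _ _).trans ?_) (hεpos k).le
    exact add_le_add_right (mul_le_mul_of_nonneg_left
      (mem_closedBall_zero_iff.1 (hk r hr)) hb.le) a
  have hslow : ∀ T, 0 ≤ T → ∀ δ > 0, ∀ᶠ k in atTop, ∀ s ∈ Icc 0 (t₀ / ε k),
      ∀ t ∈ Icc 0 (t₀ / ε k), |s - t| ≤ T → dist (xe k s) (xe k t) < δ := by
    intro T hT δ hδ
    have hlim : Tendsto (fun k => ε k * B * T) atTop (𝓝 0) := by
      simpa using (hεlim.mul_const B).mul_const T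
    filter_upwards [hspeed, hlim.eventually_lt_const hδ] with k hk hlt s hs t ht hst
    exact ((hk s hs t ht).trans
      (mul_le_mul_of_nonneg_left hst (mul_pos (hεpos k) hB).le)).trans_lt hlt
  -- the fast components are uniformly bounded
  obtain ⟨c, -, hcbound⟩ := hH2 K hK
  have hc : IsUltimateBound (fun h x y₀ => sol h x 0 y₀) K c := by
    refine hS.isUltimateBound hdense fun d hd => ?_
    obtain ⟨T, hT, hbd⟩ := hcbound d hd
    refine ⟨T, hT, fun s x hx τ hτ y₀ hy₀ => ?_⟩
    have heq := hS.eq_sol (h := σf s g0) (x := x) (v := fun t => sol g0 x s y₀ (t + s)) (T := τ)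
      (fun t ht => hS.hasDerivAt_shift (X := fun _ => x)
        (hsolode g0 x s y₀ _ (by linarith [ht.1]))) τ ⟨hT.le.trans hτ, le_rfl⟩
    rw [zero_add, hsolinit] at heq
    exact heq ▸ hbd x hx s τ hτ y₀ hy₀
  have hye : ∀ k, ∀ s ∈ Icc 0 (t₀ / ε k),
      HasDerivAt (ye k) (ev g0 (xe k s, ye k s, s)) s := by
    rw [hg0]
    exact hyeode
  obtain ⟨T, hT, δ, hδ, R, hR⟩ := hS.exists_bound_of_slow_parameter hK hc ‖yInit‖
  have hyeR : ∀ᶠ k in atTop, ∀ s ∈ Icc 0 (t₀ / ε k), ‖ye k s‖ ≤ R := by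
    filter_upwards [hxeK, hslow T hT.le δ hδ] with k hk hks
    exact hR g0 (xe k) (ye k) _ (by rw [hye0]) hk hks (hye k)
  -- the slow components converge on final segments
  have hxeT : ∀ T, ∀ δ > 0, ∀ᶠ k in atTop, ∀ s ∈ Icc (t₀ / ε k - T) (t₀ / ε k),
      dist (xe k s) (x0 t₀) < δ := by
    intro T δ hδ
    filter_upwards [hslow (max T 0) (le_max_right _ _) (δ / 2) (half_pos hδ),
      Metric.tendstoUniformlyOn_iff.1 hconv (δ / 2) (half_pos hδ),
      hτlim.eventually_ge_atTop T] with k hk hkc hkT s hs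
    have h1 := hk s ⟨by linarith [hs.1], hs.2⟩ (t₀ / ε k) ⟨(hτpos k).le, le_rfl⟩ (by
      rw [abs_sub_comm, abs_of_nonneg (by linarith [hs.2])]
      exact (by linarith [hs.1] : t₀ / ε k - s ≤ T).trans (le_max_left _ _))
    have h2 := hkc t₀ ht₀mem
    rw [dist_comm] at h2
    linarith [dist_triangle (xe k s) (xe k (t₀ / ε k)) (x0 t₀)]
  rw [tendsto_iff_ultrafilter]
  intro 𝒰 h𝒰
  obtain ⟨h, -, hh⟩ := isCompact_univ.ultrafilter_le_nhds'
    (𝒰.map fun k => σf (t₀ / ε k) g0) univ_mem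
  replace hh : Tendsto (fun k => σf (t₀ / ε k) g0) 𝒰 (𝓝 h) := hh
  obtain ⟨z, hz, hzlim⟩ := hS.exists_mem_attrFiber_tendsto hc 𝒰 (X := xe) (v := ye) hxK
    (hτlim.mono_left h𝒰) hh (fun T δ hδ => h𝒰 (hxeT T δ hδ)) (.of_forall hye) (h𝒰 hyeR)
  have htube : x0 t₀ ∈ slowTube x0 t₀ r := ⟨t₀, ht₀mem, 0, by simpa using hr.le, by simp⟩
  have hhaus := (hcont (h, x0 t₀) htube).comp (tendsto_nhdsWithin_iff.2
    ⟨hh.prodMk_nhds (tendsto_const_nhds (x := x0 t₀)), .of_forall fun _ => htube⟩)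
  have hbdd : ∀ h', Bornology.IsBounded (attrFiber ev h' (x0 t₀)) := fun h' =>
    isBounded_iff_forall_norm_le.2 ⟨c, fun z hz => hS.norm_le_of_mem_attrFiber hc hxK hz⟩
  have hsum := hhaus.add (tendsto_iff_dist_tendsto_zero.1 hzlim)
  rw [add_zero] at hsum
  refine squeeze_zero (fun _ => infDist_nonneg) (fun k => ?_) hsum
  simp only [Function.comp_apply]
  rcases (attrFiber ev (σf (t₀ / ε k) g0) (x0 t₀)).eq_empty_or_nonempty with he | hne
  · rw [he, infDist_empty]
    exact add_nonneg hausdorffDist_nonneg dist_nonneg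
  · refine infDist_le_infDist_add_dist (y := z) |>.trans (add_le_add_left ?_ _)
    rw [hausdorffDist_comm]
    exact infDist_le_hausdorffDist_of_mem hz
      (hausdorffEDist_ne_top_of_nonempty_of_bounded ⟨z, hz⟩ hne (hbdd _) (hbdd _))
end

section
/- Assume additionally that there is a continuous map η : H×K₀ → ℝᵐ with A_{(h,x)} = {η(h,x)} for all (h,x) ∈ H×K₀. Then: (a) given δ > 0 there exist T > 0 and an index k₀ with 2T < t₀/ε_{k₀} such that for every k ≥ k₀ and every τ ∈ [T, t₀/ε_k], |y_{ε_k}(τ) − η(g·τ, x₀(ε_kτ))| ≤ δ; (b) lim_{k→∞} |y_{ε_k}(t₀/ε_k) − η(g·(t₀/ε_k), x₀(t₀))| = 0; (c) if moreover g·(t₀/ε_k) → h₀ in (H,d), then h₀ ∈ O(g) and lim_{k→∞} y_{ε_k}(t₀/ε_k) = η(h₀, x₀(t₀)). -/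
open Filter Topology Metric Set

/-- A map with values eventually in a compact set converges along an ultrafilter. -/
theorem IsCompact.exists_tendsto_ultrafilter {ι E : Type*} [TopologicalSpace E] {K : Set E}
    (hK : IsCompact K) {U : Ultrafilter ι} {v : ι → E} (hv : ∀ᶠ j in U, v j ∈ K) :
    ∃ z ∈ K, Tendsto v U (𝓝 z) :=
  hK.ultrafilter_le_nhds' (U.map v) hv

section PerturbedODE

variable {X Y : Type*} [NormedAddCommGroup X] [NormedAddCommGroup Y] [NormedSpace ℝ Y]

/-- At the parameter `x`, the field `h` is Lipschitz in the state on every ball, uniformly in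
time. -/
def LipschitzOnBalls (h : C(X × Y × ℝ, Y)) (x : X) : Prop :=
  ∀ M : ℝ, ∃ L > (0 : ℝ), ∀ y₁ y₂ : Y, ‖y₁‖ ≤ M → ‖y₂‖ ≤ M → ∀ s : ℝ,
    ‖h (x, y₁, s) - h (x, y₂, s)‖ ≤ L * ‖y₁ - y₂‖

/-- `p` solves `y' = h(x, y, s)` on `[a, ∞)`. -/
def IsForwardSolution (h : C(X × Y × ℝ, Y)) (x : X) (a : ℝ) (p : ℝ → Y) : Prop :=
  ∀ s, a ≤ s → HasDerivAt p (h (x, p s, s)) s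

/-- Through each initial value of norm at most `d` there is a forward solution whose norm is at
most `c` from time `T` after the start on. -/
def UltimatelyBoundedBy (h : C(X × Y × ℝ, Y)) (x : X) (c d T : ℝ) : Prop :=
  ∀ (a : ℝ) (y : Y), ‖y‖ ≤ d → ∃ q : ℝ → Y, q a = y ∧ IsForwardSolution h x a q ∧
    ∀ s, a + T ≤ s → ‖q s‖ ≤ c

/-- Compatible forward solutions starting at the times `-N` glue to an entire solution. -/
theorem exists_entire_solution_of_compatible {h : C(X × Y × ℝ, Y)} {x : X} {p : ℕ → ℝ → Y}
    (hp : ∀ N : ℕ, IsForwardSolution h x (-N) (p N))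
    (hcomp : ∀ N M : ℕ, N ≤ M → ∀ s : ℝ, -(N : ℝ) ≤ s → p M s = p N s) :
    ∃ w : ℝ → Y, (∀ (N : ℕ) (s : ℝ), -(N : ℝ) ≤ s → w s = p N s) ∧
      ∀ s, HasDerivAt w (h (x, w s, s)) s := by
  have hceil : ∀ s : ℝ, -((⌈-s⌉₊ : ℕ) : ℝ) ≤ s := fun s => by linarith [Nat.le_ceil (-s)]
  have hw : ∀ (N : ℕ) (s : ℝ), -(N : ℝ) ≤ s → p ⌈-s⌉₊ s = p N s := fun N s hs => by
    have : ⌈-s⌉₊ ≤ N := Nat.ceil_le.2 (by linarith)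
    exact (hcomp _ _ this s (hceil s)).symm
  refine ⟨fun s => p ⌈-s⌉₊ s, hw, fun s => ?_⟩
  have hs : -((⌈-s⌉₊ + 1 : ℕ) : ℝ) < s := by
    have := hceil s
    push_cast
    linarith
  have hd := hp (⌈-s⌉₊ + 1) s hs.le
  rw [← hw _ s hs.le] at hd
  refine hd.congr_of_eventuallyEq ?_
  filter_upwards [lt_mem_nhds hs] with t ht
  exact hw _ t ht.le

variable [ProperSpace X] [ProperSpace Y]

/-- Solutions depend continuously on the field, the parameter path and the initial value. -/
theorem eventually_norm_sub_le_of_tendsto {ι : Type*} {l : Filter ι}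
    {h : C(X × Y × ℝ, Y)} {x : X} (hL : LipschitzOnBalls h x)
    {u : ι → C(X × Y × ℝ, Y)} (hu : Tendsto u l (𝓝 h))
    {a b : ℝ} {p : ℝ → Y} (hp : IsForwardSolution h x a p)
    {y : ι → ℝ → Y} {ξ : ι → ℝ → X} {S : ι → ℝ}
    (hS : ∀ᶠ j in l, S j ≤ b)
    (hy : ∀ᶠ j in l, ∀ s ∈ Icc a (S j), HasDerivAt (y j) (u j (ξ j s, y j s, s)) s)
    (hξ : ∀ ρ > (0 : ℝ), ∀ᶠ j in l, ∀ s ∈ Icc a (S j), ‖ξ j s - x‖ ≤ ρ)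
    (hinit : Tendsto (fun j => y j a) l (𝓝 (p a)))
    {δ : ℝ} (hδ : 0 < δ) :
    ∀ᶠ j in l, ∀ s ∈ Icc a (S j), ‖y j s - p s‖ ≤ δ := by
  wlog hδ1 : δ ≤ 1 generalizing δ
  · filter_upwards [this one_pos le_rfl] with j hj s hs
    exact (hj s hs).trans (not_le.1 hδ1).le
  have hpc : ContinuousOn p (Icc a b) := fun s hs => (hp s hs.1).continuousAt.continuousWithinAt
  obtain ⟨M, hM⟩ := isCompact_Icc.exists_bound_of_continuousOn hpc
  obtain ⟨L, hL0, hL⟩ := hL (M + 1)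
  set κ : ℝ := δ * Real.exp (-((L + 1) * (b - a))) with hκ
  have hκ0 : 0 < κ := by positivity
  set Q : Set (X × Y × ℝ) := closedBall x 1 ×ˢ (closedBall (0 : Y) (M + 1) ×ˢ Icc a b)
  have hQc : IsCompact Q :=
    (isCompact_closedBall x 1).prod ((isCompact_closedBall _ _).prod isCompact_Icc)
  have hconv := ContinuousMap.tendsto_iff_forall_isCompact_tendstoUniformlyOn.1 hu Q hQc
  have h1 := Metric.tendstoUniformlyOn_iff.1 hconv (κ / 2) (half_pos hκ0)
  obtain ⟨ρ, hρ0, hρ⟩ := Metric.uniformContinuousOn_iff.1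
    (hQc.uniformContinuousOn_of_continuous h.continuous.continuousOn) (κ / 2) (half_pos hκ0)
  have h2 := hξ (min (ρ / 2) 1) (by positivity)
  have h3 := Metric.tendsto_nhds.1 hinit κ hκ0
  filter_upwards [hS, hy, h1, h2, h3] with j hSj hyj h1 h2 h3 s hs
  have hmem : ∀ t ∈ Icc a (S j), t ∈ Icc a b := fun t ht => ⟨ht.1, ht.2.trans hSj⟩
  have hB : ∀ t ∈ Icc a (S j), κ * Real.exp ((L + 1) * (t - a)) ≤ δ := by
    intro t ht
    rw [hκ, mul_assoc, ← Real.exp_add]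
    have : Real.exp (-((L + 1) * (b - a)) + (L + 1) * (t - a)) ≤ 1 :=
      Real.exp_le_one_iff.2 (by nlinarith [(hmem t ht).2])
    nlinarith
  have hder : ∀ t ∈ Icc a (S j), HasDerivAt (fun t => y j t - p t)
      (u j (ξ j t, y j t, t) - h (x, p t, t)) t :=
    fun t ht => (hyj t ht).sub (hp t ht.1)
  have hBder : ∀ t, HasDerivAt (fun t => κ * Real.exp ((L + 1) * (t - a)))
      (κ * (Real.exp ((L + 1) * (t - a)) * ((L + 1) * 1))) t := fun t =>
    ((((hasDerivAt_id t).sub_const a).const_mul (L + 1)).exp).const_mul κ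
  refine (image_norm_le_of_norm_deriv_right_lt_deriv_boundary'
    (f := fun t => y j t - p t)
    (f' := fun t => u j (ξ j t, y j t, t) - h (x, p t, t))
    (B := fun t => κ * Real.exp ((L + 1) * (t - a)))
    (B' := fun t => κ * (Real.exp ((L + 1) * (t - a)) * ((L + 1) * 1)))
    (fun t ht => (hder t ht).continuousAt.continuousWithinAt)
    (fun t ht => (hder t ⟨ht.1, ht.2.le⟩).hasDerivWithinAt) ?_
    (fun t _ => (hBder t).continuousAt.continuousWithinAt)
    (fun t _ => (hBder t).hasDerivWithinAt) ?_ hs).trans (hB s hs)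
  · simpa [dist_eq_norm] using h3.le
  · intro t ht heq
    have ht' : t ∈ Icc a (S j) := ⟨ht.1, ht.2.le⟩
    have hpt := hM t (hmem t ht')
    have hsub : ‖y j t - p t‖ ≤ 1 := heq.le.trans ((hB t ht').trans hδ1)
    have hyt : ‖y j t‖ ≤ M + 1 := by
      have := norm_add_le (p t) (y j t - p t)
      rw [add_sub_cancel] at this
      linarith
    have hξt := h2 t ht'
    have m1 : (ξ j t, y j t, t) ∈ Q := by
      refine ⟨?_, ?_, hmem t ht'⟩
      · simpa [dist_eq_norm] using hξt.trans (min_le_right _ _)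
      · simpa using hyt
    have m2 : (x, y j t, t) ∈ Q := by
      refine ⟨?_, ?_, hmem t ht'⟩
      · simp
      · simpa using hyt
    have e1 : ‖u j (ξ j t, y j t, t) - h (ξ j t, y j t, t)‖ < κ / 2 := by
      have := h1 _ m1
      rwa [dist_comm, dist_eq_norm] at this
    have e2 : ‖h (ξ j t, y j t, t) - h (x, y j t, t)‖ < κ / 2 := by
      rw [← dist_eq_norm]
      refine hρ _ m1 _ m2 ?_
      simp only [Prod.dist_eq, dist_self]
      rw [dist_eq_norm, max_eq_left (norm_nonneg _)]
      linarith [hξt.trans (min_le_left _ _)]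
    have e3 := hL (y j t) (p t) hyt (hpt.trans (by linarith)) t
    have hexp : 1 ≤ Real.exp ((L + 1) * (t - a)) :=
      Real.one_le_exp (mul_nonneg (by linarith) (sub_nonneg.2 ht.1))
    have tri : ‖u j (ξ j t, y j t, t) - h (x, p t, t)‖ ≤
        ‖u j (ξ j t, y j t, t) - h (ξ j t, y j t, t)‖ +
        ‖h (ξ j t, y j t, t) - h (x, y j t, t)‖ + ‖h (x, y j t, t) - h (x, p t, t)‖ := by
      have := norm_add₃_le (a := u j (ξ j t, y j t, t) - h (ξ j t, y j t, t))
        (b := h (ξ j t, y j t, t) - h (x, y j t, t)) (c := h (x, y j t, t) - h (x, p t, t))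
      simpa using this
    rw [heq] at e3
    nlinarith

/-- Forward solutions are determined by their initial value. -/
theorem IsForwardSolution.eq_of_eq {h : C(X × Y × ℝ, Y)} {x : X} (hL : LipschitzOnBalls h x)
    {a : ℝ} {p q : ℝ → Y} (hp : IsForwardSolution h x a p) (hq : IsForwardSolution h x a q)
    (hpq : q a = p a) {s : ℝ} (hs : a ≤ s) : q s = p s := by
  refine eq_of_forall_dist_le fun δ hδ => ?_
  have := eventually_norm_sub_le_of_tendsto (l := pure ()) hL (u := fun _ => h)
    tendsto_const_nhds hp (b := s) (y := fun _ => q) (ξ := fun _ _ => x) (S := fun _ => s)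
    (by simp) (by simpa using fun t ht _ => hq t ht) (by simp +contextual [le_of_lt])
    (by simp [hpq]) hδ
  rw [dist_eq_norm]
  exact (eventually_pure.1 this) s ⟨hs, le_rfl⟩

/-- Ultimate boundedness passes to limits of fields. -/
theorem IsForwardSolution.norm_le_of_tendsto {ι : Type*} {l : Filter ι} [l.NeBot]
    {h : C(X × Y × ℝ, Y)} {x : X} (hL : LipschitzOnBalls h x)
    {u : ι → C(X × Y × ℝ, Y)} (hu : Tendsto u l (𝓝 h)) {c d T : ℝ} (hT : 0 ≤ T)
    (hb : ∀ j, UltimatelyBoundedBy (u j) x c d T)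
    {a : ℝ} {p : ℝ → Y} (hp : IsForwardSolution h x a p) (hd : ‖p a‖ ≤ d)
    {s : ℝ} (hs : a + T ≤ s) : ‖p s‖ ≤ c := by
  choose q hq0 hq hqc using fun j => hb j a (p a) hd
  refine le_of_forall_pos_le_add fun δ hδ => ?_
  obtain ⟨j, hj⟩ := (eventually_norm_sub_le_of_tendsto hL hu hp (b := s) (y := q)
    (ξ := fun _ _ => x) (S := fun _ => s) (Eventually.of_forall fun _ => le_rfl)
    (Eventually.of_forall fun j t ht => hq j t ht.1)
    (fun ρ hρ => Eventually.of_forall fun _ _ _ => by simpa using hρ.le)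
    (by simp [hq0]) hδ).exists
  have h1 := hj s ⟨by linarith, le_rfl⟩
  have h2 := hqc j s hs
  have h3 := norm_le_norm_add_norm_sub (q j s) (p s)
  linarith

/-- Limits of bounded solutions of perturbed equations on backward half-lines exhausting
`(-∞, 0]` are values at time `0` of bounded entire solutions of the limit equation. -/
theorem exists_bounded_entire_solution_of_ultrafilter {ι : Type*} {U : Ultrafilter ι}
    {h : C(X × Y × ℝ, Y)} {x : X} (hL : LipschitzOnBalls h x)
    (hsol : ∀ (a : ℝ) (y : Y), ∃ p : ℝ → Y, p a = y ∧ IsForwardSolution h x a p)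
    {u : ι → C(X × Y × ℝ, Y)} (hu : Tendsto u U (𝓝 h)) {c R T : ℝ} (hT : 0 ≤ T)
    (hb : ∀ j, UltimatelyBoundedBy (u j) x c R T)
    {y : ι → ℝ → Y} {ξ : ι → ℝ → X}
    (hy : ∀ a : ℝ, ∀ᶠ j in U, ∀ s ∈ Icc a 0, HasDerivAt (y j) (u j (ξ j s, y j s, s)) s)
    (hξ : ∀ a : ℝ, ∀ ρ > (0 : ℝ), ∀ᶠ j in U, ∀ s ∈ Icc a 0, ‖ξ j s - x‖ ≤ ρ)
    (hR : ∀ a : ℝ, ∀ᶠ j in U, ∀ s ∈ Icc a 0, ‖y j s‖ ≤ R) :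
    ∃ w : ℝ → Y, Tendsto (fun j => y j 0) U (𝓝 (w 0)) ∧ (∃ C, ∀ s, ‖w s‖ ≤ C) ∧
      ∀ s, HasDerivAt w (h (x, w s, s)) s := by
  have hlim : ∀ N : ℕ, ∃ z : Y, ‖z‖ ≤ R ∧ Tendsto (fun j => y j (-(N : ℝ))) U (𝓝 z) := by
    intro N
    have hN : ∀ᶠ j in U, y j (-(N : ℝ)) ∈ closedBall (0 : Y) R := by
      filter_upwards [hR (-N)] with j hj
      simpa using hj (-N) ⟨le_rfl, by simp⟩
    obtain ⟨z, hz, hz'⟩ := (isCompact_closedBall (0 : Y) R).exists_tendsto_ultrafilter hN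
    exact ⟨z, by simpa using hz, hz'⟩
  choose z hzR hz using hlim
  choose p hp0 hp using fun N : ℕ => hsol (-(N : ℝ)) (z N)
  have htrack : ∀ N M : ℕ, N ≤ M → p M (-(N : ℝ)) = z N := by
    intro N M hNM
    have hNM' : (N : ℝ) ≤ M := by exact_mod_cast hNM
    refine tendsto_nhds_unique (Metric.tendsto_nhds.2 fun δ hδ => ?_) (hz N)
    filter_upwards [eventually_norm_sub_le_of_tendsto hL hu (hp M) (b := 0) (S := fun _ => 0)
      (Eventually.of_forall fun _ => le_rfl) (hy (-M)) (hξ (-M))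
      (by simpa [hp0] using hz M) (half_pos hδ)] with j hj
    rw [dist_eq_norm]
    linarith [hj (-N) ⟨by linarith, by simp⟩]
  have hcomp : ∀ N M : ℕ, N ≤ M → ∀ s : ℝ, -(N : ℝ) ≤ s → p M s = p N s := by
    intro N M hNM s hs
    have hNM' : (N : ℝ) ≤ M := by exact_mod_cast hNM
    exact (hp N).eq_of_eq hL (fun t ht => hp M t (by linarith))
      (by rw [htrack N M hNM, hp0]) hs
  obtain ⟨w, hw, hw'⟩ := exists_entire_solution_of_compatible hp hcomp
  refine ⟨w, ?_, ⟨c, fun s => ?_⟩, hw'⟩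
  · have := hp0 0
    have h0 := hz 0
    rw [Nat.cast_zero, neg_zero] at this h0
    rwa [hw 0 0 (by simp), this]
  · obtain ⟨N, hN⟩ := exists_nat_ge (T - s)
    rw [hw N s (by linarith)]
    exact (hp N).norm_le_of_tendsto hL hu hT hb (by rw [hp0]; exact hzR N) (by linarith)

end PerturbedODE

/-- If every segment of length `T` starting in the ball of radius `d` stays in the ball of radius
`R` and ends in the ball of radius `d`, then the whole path stays in the ball of radius `R`. -/
theorem norm_le_of_forall_segment {Y : Type*} [NormedAddCommGroup Y] {y : ℝ → Y}
    {d R T Θ : ℝ} (hT : 0 < T) (h0 : ‖y 0‖ ≤ d)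
    (hstay : ∀ τ s : ℝ, 0 ≤ τ → ‖y τ‖ ≤ d → s ∈ Icc 0 T → τ + s ≤ Θ → ‖y (τ + s)‖ ≤ R)
    (hend : ∀ τ : ℝ, 0 ≤ τ → ‖y τ‖ ≤ d → τ + T ≤ Θ → ‖y (τ + T)‖ ≤ d)
    {τ : ℝ} (hτ : τ ∈ Icc 0 Θ) : ‖y τ‖ ≤ R := by
  have hN : ∀ N : ℕ, N * T ≤ Θ → ‖y (N * T)‖ ≤ d := by
    intro N
    induction N with
    | zero => simpa using fun _ => h0
    | succ N ih =>
      intro hle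
      push_cast [add_mul, one_mul] at hle ⊢
      exact hend _ (by positivity) (ih (by linarith)) hle
  have h1 : (⌊τ / T⌋₊ : ℝ) * T ≤ τ :=
    (le_div_iff₀ hT).1 (Nat.floor_le (div_nonneg hτ.1 hT.le))
  have h2 : τ < (⌊τ / T⌋₊ + 1 : ℝ) * T := (div_lt_iff₀ hT).1 (Nat.lt_floor_add_one _)
  have := hstay (⌊τ / T⌋₊ * T) (τ - ⌊τ / T⌋₊ * T) (by positivity)
    (hN _ (h1.trans hτ.2)) ⟨by linarith, by linarith⟩ (by linarith [hτ.2])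
  simpa using this

/-- Elements of the hull inherit the Lipschitz bounds of `g`. -/
theorem lipschitzOnBalls_of_mem_closure {n m : ℕ}
    {g h : C(EuclideanSpace ℝ (Fin n) × EuclideanSpace ℝ (Fin m) × ℝ,
      EuclideanSpace ℝ (Fin m))} (hlip : IsLipschitzInY g)
    (hh : h ∈ closure {h | ∃ s : ℝ, h = timeTranslate s g}) (x : EuclideanSpace ℝ (Fin n)) :
    LipschitzOnBalls h x := by
  intro M
  obtain ⟨L, hL0, hL⟩ := hlip {x} isCompact_singleton (closedBall 0 M) (isCompact_closedBall _ _)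
  refine ⟨L, hL0, fun y₁ y₂ h₁ h₂ s => ?_⟩
  have hclosed : IsClosed {v : C(EuclideanSpace ℝ (Fin n) × EuclideanSpace ℝ (Fin m) × ℝ,
      EuclideanSpace ℝ (Fin m)) | ‖v (x, y₁, s) - v (x, y₂, s)‖ ≤ L * ‖y₁ - y₂‖} :=
    isClosed_le (((continuous_eval_const _).sub
      (continuous_eval_const _)).norm) continuous_const
  refine closure_minimal ?_ hclosed hh
  rintro _ ⟨t, rfl⟩
  exact hL x rfl y₁ (by simpa using h₁) y₂ (by simpa using h₂) (s + t)

/-- A path converging uniformly in the slow time is asymptotically constant on bounded windows of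
the fast time. -/
theorem eventually_norm_sub_le_of_slow {E ι : Type*} [NormedAddCommGroup E] {l : Filter ι}
    {t₀ : ℝ} {ε : ℕ → ℝ} (hεpos : ∀ k, 0 < ε k) (hεlim : Tendsto ε atTop (𝓝 0))
    {xe : ℕ → ℝ → E} {x0 : ℝ → E} (hx0cont : ContinuousOn x0 (Icc 0 t₀))
    (hconv : TendstoUniformlyOn (fun k t => xe k (t / ε k)) x0 atTop (Icc 0 t₀))
    {κ : ι → ℕ} (hκ : Tendsto κ l atTop) {τ : ι → ℝ}
    (hτ : ∀ j, τ j ∈ Icc 0 (t₀ / ε (κ j))) {x : E}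
    (hx : Tendsto (fun j => x0 (ε (κ j) * τ j)) l (𝓝 x)) (C : ℝ) {ρ : ℝ} (hρ : 0 < ρ) :
    ∀ᶠ j in l, ∀ s, |s| ≤ C → τ j + s ∈ Icc 0 (t₀ / ε (κ j)) →
      ‖xe (κ j) (τ j + s) - x‖ ≤ ρ := by
  have hslow : ∀ j σ, σ ∈ Icc 0 (t₀ / ε (κ j)) → ε (κ j) * σ ∈ Icc 0 t₀ := fun j σ hσ =>
    ⟨mul_nonneg (hεpos _).le hσ.1, by
      have := (le_div_iff₀ (hεpos (κ j))).1 hσ.2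
      linarith⟩
  obtain ⟨θ, hθ0, hθ⟩ := Metric.uniformContinuousOn_iff.1
    (isCompact_Icc.uniformContinuousOn_of_continuous hx0cont) (ρ / 3) (by positivity)
  have hε : Tendsto (fun j => ε (κ j) * C) l (𝓝 0) := by
    simpa using (hεlim.comp hκ).mul_const C
  filter_upwards [hκ.eventually (Metric.tendstoUniformlyOn_iff.1 hconv (ρ / 3) (by positivity)),
    Metric.tendsto_nhds.1 hx (ρ / 3) (by positivity), hε.eventually (gt_mem_nhds hθ0)]
    with j h1 h2 h3 s hs hmem
  have e1 := h1 _ (hslow j _ hmem)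
  rw [mul_div_cancel_left₀ _ (hεpos _).ne'] at e1
  have e2 : dist (x0 (ε (κ j) * (τ j + s))) (x0 (ε (κ j) * τ j)) < ρ / 3 := by
    refine hθ _ (hslow j _ hmem) _ (hslow j _ (hτ j)) ?_
    rw [Real.dist_eq, mul_add, add_sub_cancel_left, abs_mul, abs_of_pos (hεpos _)]
    exact (mul_le_mul_of_nonneg_left hs (hεpos _).le).trans_lt h3
  rw [← dist_eq_norm]
  have := dist_triangle4 (xe (κ j) (τ j + s)) (x0 (ε (κ j) * (τ j + s)))
    (x0 (ε (κ j) * τ j)) x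
  rw [dist_comm] at e1
  linarith

/-- when the attractor is a continuous copy of the base, the fast motion tracks the copy η. -/
theorem stmt_16
    {n m : ℕ} (hn : 1 ≤ n) (hm : 1 ≤ m)
    -- g, admissible and Lipschitz in y on compacts
    (g : C(EuclideanSpace ℝ (Fin n) × EuclideanSpace ℝ (Fin m) × ℝ,
      EuclideanSpace ℝ (Fin m)))
    (hadm : IsAdmissibleMap g) (hlip : IsLipschitzInY g)
    -- the hull H of g, a compact metric space with the continuous shift flow,
    -- identified via the embedding ev with the closure of the translates of g
    (H : Type) [MetricSpace H] [CompactSpace H]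
    (σf : ℝ → H → H)
    (hσcont : Continuous fun p : ℝ × H => σf p.1 p.2)
    (hσ0 : ∀ h, σf 0 h = h)
    (hσadd : ∀ s t : ℝ, ∀ h, σf (s + t) h = σf s (σf t h))
    (ev : H → C(EuclideanSpace ℝ (Fin n) × EuclideanSpace ℝ (Fin m) × ℝ,
      EuclideanSpace ℝ (Fin m)))
    (hev : Topology.IsEmbedding ev)
    (hrange : Set.range ev = closure {h | ∃ s : ℝ, h = timeTranslate s g})
    (g0 : H) (hg0 : ev g0 = g)
    (hequiv : ∀ (s : ℝ) (h : H), ev (σf s h) = timeTranslate s (ev h))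
    -- the (unique, maximal) solutions y(τ,h,x,τ₀,y₀) of y' = h(x,y,τ)
    (sol : H → EuclideanSpace ℝ (Fin n) → ℝ → EuclideanSpace ℝ (Fin m) → ℝ →
      EuclideanSpace ℝ (Fin m))
    (hsolinit : ∀ h x τ₀ y₀, sol h x τ₀ y₀ τ₀ = y₀)
    -- (H1): all solutions over the hull are globally defined in the future
    (hsolode : ∀ h x (τ₀ : ℝ) y₀ (τ : ℝ), τ₀ ≤ τ →
      HasDerivAt (sol h x τ₀ y₀) (ev h (x, sol h x τ₀ y₀ τ, τ)) τ)
    -- (H2): uniform ultimate boundedness over compact sets of parameters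
    (hH2 : ∀ K₀ : Set (EuclideanSpace ℝ (Fin n)), IsCompact K₀ →
      ∃ c > (0:ℝ), ∀ d > (0:ℝ), ∃ T > (0:ℝ), ∀ x ∈ K₀, ∀ τ₀ : ℝ, ∀ τ ≥ T,
        ∀ y₀ : EuclideanSpace ℝ (Fin m), ‖y₀‖ ≤ d → ‖sol g0 x τ₀ y₀ (τ + τ₀)‖ ≤ c)
    -- the slow vector field f, continuous and of linear growth
    (f : EuclideanSpace ℝ (Fin n) → EuclideanSpace ℝ (Fin m) → EuclideanSpace ℝ (Fin n))
    (hf : Continuous fun p : EuclideanSpace ℝ (Fin n) × EuclideanSpace ℝ (Fin m) =>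
      f p.1 p.2)
    (a b : ℝ) (ha : 0 < a) (hb : 0 < b)
    (hgrowth : ∀ x y, ‖f x y‖ ≤ a + b * ‖x‖)
    -- initial data, final slow time, the sequence ε_k ↓ 0, and the solutions
    -- (x_{ε_k}, y_{ε_k}) of the slow-fast system in the fast time
    (xInit : EuclideanSpace ℝ (Fin n)) (yInit : EuclideanSpace ℝ (Fin m))
    (t₀ : ℝ) (ht₀ : 0 < t₀)
    (ε : ℕ → ℝ) (hεpos : ∀ k, 0 < ε k) (hεanti : StrictAnti ε)
    (hεlim : Tendsto ε atTop (𝓝 0))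
    (xe : ℕ → ℝ → EuclideanSpace ℝ (Fin n)) (ye : ℕ → ℝ → EuclideanSpace ℝ (Fin m))
    (hxe0 : ∀ k, xe k 0 = xInit) (hye0 : ∀ k, ye k 0 = yInit)
    (hxeode : ∀ k : ℕ, ∀ τ ∈ Set.Icc (0:ℝ) (t₀ / ε k),
      HasDerivAt (xe k) (ε k • f (xe k τ) (ye k τ)) τ)
    (hyeode : ∀ k : ℕ, ∀ τ ∈ Set.Icc (0:ℝ) (t₀ / ε k),
      HasDerivAt (ye k) (g (xe k τ, ye k τ, τ)) τ)
    -- the slow components converge uniformly (in the slow time) to x₀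
    (x0 : ℝ → EuclideanSpace ℝ (Fin n)) (hx0cont : ContinuousOn x0 (Set.Icc 0 t₀))
    (hconv : TendstoUniformlyOn (fun k t => xe k (t / ε k)) x0 atTop (Set.Icc 0 t₀))
    -- the radius of the compact tube K₀ around x₀
    (r : ℝ) (hr : 0 < r)
    -- the attractor is a copy of the base given by a continuous map η
    (η : H → EuclideanSpace ℝ (Fin n) → EuclideanSpace ℝ (Fin m))
    (hηcont : ContinuousOn (fun p : H × EuclideanSpace ℝ (Fin n) => η p.1 p.2)
      (Set.univ ×ˢ slowTube x0 t₀ r))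
    (hη : ∀ (h : H), ∀ x ∈ slowTube x0 t₀ r, attrFiber ev h x = {η h x}) :
    (∀ δ > (0:ℝ), ∃ T > (0:ℝ), ∃ k₀ : ℕ, 2 * T < t₀ / ε k₀ ∧
        ∀ k ≥ k₀, ∀ τ ∈ Set.Icc T (t₀ / ε k),
          ‖ye k τ - η (σf τ g0) (x0 (ε k * τ))‖ ≤ δ) ∧
      Tendsto (fun k : ℕ => ‖ye k (t₀ / ε k) - η (σf (t₀ / ε k) g0) (x0 t₀)‖)
        atTop (𝓝 0) ∧
      ∀ h₀ : H, Tendsto (fun k : ℕ => σf (t₀ / ε k) g0) atTop (𝓝 h₀) →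
        h₀ ∈ omegaSet σf g0 ∧
        Tendsto (fun k : ℕ => ye k (t₀ / ε k)) atTop (𝓝 (η h₀ (x0 t₀))) := by
  have hslow : ∀ k, ∀ σ ∈ Icc 0 (t₀ / ε k), ε k * σ ∈ Icc 0 t₀ := fun k σ hσ =>
    ⟨mul_nonneg (hεpos _).le hσ.1, by
      have := (le_div_iff₀ (hεpos k)).1 hσ.2
      linarith⟩
  have hΘ : Tendsto (fun k => t₀ / ε k) atTop atTop := by
    have : Tendsto ε atTop (𝓝[>] 0) :=
      tendsto_nhdsWithin_iff.2 ⟨hεlim, Eventually.of_forall hεpos⟩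
    simpa [div_eq_mul_inv] using (tendsto_inv_nhdsGT_zero.comp this).const_mul_atTop ht₀
  set K : Set (EuclideanSpace ℝ (Fin n)) := x0 '' Icc 0 t₀
  have hKc : IsCompact K := isCompact_Icc.image_of_continuousOn hx0cont
  have hKtube : K ⊆ slowTube x0 t₀ r := by
    rintro _ ⟨t, ht, rfl⟩
    exact ⟨t, ht, 0, by simpa using hr.le, by simp⟩
  obtain ⟨c, hc0, hH2⟩ := hH2 K hKc
  have hsolg : ∀ x t a y, IsForwardSolution (timeTranslate t g) x a
      (fun s => sol g0 x (a + t) y (s + t)) := fun x t a y s hs => by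
    have := hsolode g0 x (a + t) y (s + t) (by linarith)
    rw [hg0] at this
    exact this.comp_add_const s t
  have hUB : ∀ d > (0 : ℝ), ∃ T > (0 : ℝ), ∀ x ∈ K, ∀ t,
      UltimatelyBoundedBy (timeTranslate t g) x c d T := by
    intro d hd
    obtain ⟨T, hT0, hT⟩ := hH2 d hd
    refine ⟨T, hT0, fun x hx t a y hy => ⟨_, hsolinit g0 x (a + t) y, hsolg x t a y, ?_⟩⟩
    intro s hs
    have := hT x hx (a + t) (s - a) (by linarith) y hy
    rwa [show s - a + (a + t) = s + t by ring] at this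
  have hL : ∀ h x, LipschitzOnBalls (ev h) x := fun h x =>
    lipschitzOnBalls_of_mem_closure hlip (hrange ▸ mem_range_self h) x
  have hsol : ∀ h x a, ∀ y, ∃ p : ℝ → EuclideanSpace ℝ (Fin m),
      p a = y ∧ IsForwardSolution (ev h) x a p := fun h x a y =>
    ⟨sol h x a y, hsolinit h x a y, hsolode h x a y⟩
  -- limits of the data along ultrafilters
  have hcpt : ∀ (U : Ultrafilter ℕ) (κ : ℕ → ℕ) (τ : ℕ → ℝ),
      (∀ j, τ j ∈ Icc 0 (t₀ / ε (κ j))) → ∃ h, ∃ x ∈ K,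
        Tendsto (fun j => σf (τ j) g0) U (𝓝 h) ∧
        Tendsto (fun j => timeTranslate (τ j) g) U (𝓝 (ev h)) ∧
        Tendsto (fun j => x0 (ε (κ j) * τ j)) U (𝓝 x) := by
    intro U κ τ hτ
    obtain ⟨h, -, hh⟩ := isCompact_univ.exists_tendsto_ultrafilter (U := U)
      (v := fun j => σf (τ j) g0) univ_mem
    obtain ⟨x, hx, hx'⟩ := hKc.exists_tendsto_ultrafilter (U := U)
      (Eventually.of_forall fun j => mem_image_of_mem x0 (hslow _ _ (hτ j)))
    refine ⟨h, x, hx, hh, ?_, hx'⟩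
    have : Tendsto (fun j => ev (σf (τ j) g0)) U (𝓝 (ev h)) :=
      (hev.continuous.tendsto h).comp hh
    simpa only [hequiv, hg0] using this
  have hyeshift : ∀ k τ s, τ + s ∈ Icc 0 (t₀ / ε k) → HasDerivAt (fun s => ye k (τ + s))
      (timeTranslate τ g (xe k (τ + s), ye k (τ + s), s)) s := by
    intro k τ s hs
    have := (hyeode k (τ + s) hs).comp_const_add τ s
    simpa [timeTranslate, add_comm] using this
  have hU : (hyperfilter ℕ : Filter ℕ) ≤ atTop := Nat.hyperfilter_le_atTop
  -- the fast components are uniformly bounded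
  obtain ⟨R, hR0, hR⟩ : ∃ R > (0 : ℝ), ∀ᶠ k in atTop, ∀ τ ∈ Icc 0 (t₀ / ε k), ‖ye k τ‖ ≤ R := by
    set d := max (c + 1) ‖yInit‖ with hd
    have hcd : c + 1 ≤ d := le_max_left _ _
    obtain ⟨T, hT0, hT⟩ := hUB d (by linarith)
    obtain ⟨R, hR⟩ : ∃ R : ℕ, ∀ᶠ k in atTop, ∀ τ s, 0 ≤ τ → ‖ye k τ‖ ≤ d → s ∈ Icc 0 T →
        τ + s ≤ t₀ / ε k → ‖ye k (τ + s)‖ ≤ R ∧ (s = T → ‖ye k (τ + s)‖ ≤ d) := by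
      by_contra! hcon
      choose κ hκ τ s hτ0 hτd hs hle hbad using
        fun j : ℕ => ((hcon j).and_eventually (eventually_ge_atTop j)).exists.imp
          fun k hk => And.intro hk.2 hk.1
      have hκ' : Tendsto κ (hyperfilter ℕ : Filter ℕ) atTop :=
        (tendsto_atTop_mono hκ tendsto_id).mono_left hU
      have hτ : ∀ j, τ j ∈ Icc 0 (t₀ / ε (κ j)) := fun j =>
        ⟨hτ0 j, by linarith [(hs j).1, hle j]⟩
      obtain ⟨h, x, hx, -, hu, hx'⟩ := hcpt (hyperfilter ℕ) κ τ hτ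
      obtain ⟨y, hy, hy'⟩ := (isCompact_closedBall (0 : EuclideanSpace ℝ (Fin m)) d
        ).exists_tendsto_ultrafilter (U := hyperfilter ℕ) (v := fun j => ye (κ j) (τ j))
        (Eventually.of_forall fun j => by simpa using hτd j)
      obtain ⟨p, hp0, hp⟩ := hsol h x 0 y
      obtain ⟨M, hM⟩ := isCompact_Icc.exists_bound_of_continuousOn (s := Icc 0 T) (f := p)
        fun s hs => (hp s hs.1).continuousAt.continuousWithinAt
      have hwin : ∀ j, ∀ t ∈ Icc 0 (s j), τ j + t ∈ Icc 0 (t₀ / ε (κ j)) := fun j t ht =>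
        ⟨by linarith [hτ0 j, ht.1], by linarith [hle j, ht.2]⟩
      have htrack := eventually_norm_sub_le_of_tendsto (hL h x) hu hp (b := T) (S := s)
        (y := fun j t => ye (κ j) (τ j + t)) (ξ := fun j t => xe (κ j) (τ j + t))
        (Eventually.of_forall fun j => (hs j).2)
        (Eventually.of_forall fun j t ht => hyeshift _ _ _ (hwin j t ht))
        (fun ρ hρ => by
          filter_upwards [eventually_norm_sub_le_of_slow hεpos hεlim hx0cont hconv hκ' hτ hx' T hρ]
            with j hj t ht
          exact hj t (by rw [abs_of_nonneg ht.1]; exact ht.2.trans (hs j).2) (hwin j t ht))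
        (by simpa [hp0] using hy') one_pos
      obtain ⟨N, hN⟩ := exists_nat_ge (M + 1)
      obtain ⟨j, hj, hjN⟩ := (htrack.and (hU (eventually_ge_atTop N))).exists
      have h1 := hj (s j) ⟨(hs j).1, le_rfl⟩
      have h2 := norm_le_norm_add_norm_sub' (ye (κ j) (τ j + s j)) (p (s j))
      have hjN' : (N : ℝ) ≤ j := by exact_mod_cast hjN
      obtain ⟨hsT, hlt⟩ := hbad j (by linarith [hM _ (hs j)])
      have h3 : ‖p (s j)‖ ≤ c := hp.norm_le_of_tendsto (hL h x) hu hT0.le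
        (fun j => hT x hx (τ j)) (by simpa [hp0] using hy) (by simp [hsT])
      linarith
    refine ⟨R + 1, by positivity, ?_⟩
    filter_upwards [hR] with k hk τ hτ
    refine (norm_le_of_forall_segment hT0 (by simp [hye0, hd])
      (fun τ s h1 h2 h3 h4 => (hk τ s h1 h2 h3 h4).1)
      (fun τ h1 h2 h3 => (hk τ T h1 h2 ⟨hT0.le, le_rfl⟩ h3).2 rfl) hτ).trans (by linarith)
  have hηlim : ∀ {l : Filter ℕ} {h : ℕ → H} {h' : H} {z : ℕ → EuclideanSpace ℝ (Fin n)}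
      {x : EuclideanSpace ℝ (Fin n)}, Tendsto h l (𝓝 h') → Tendsto z l (𝓝 x) → (∀ j, z j ∈ K) →
      x ∈ K → Tendsto (fun j => η (h j) (z j)) l (𝓝 (η h' x)) := by
    intro l h h' z x hh hz hzK hx
    exact (hηcont (h', x) ⟨mem_univ _, hKtube hx⟩).tendsto.comp
      (tendsto_nhdsWithin_iff.2 ⟨hh.prodMk_nhds hz,
        Eventually.of_forall fun j => ⟨mem_univ _, hKtube (hzK j)⟩⟩)
  have key : ∀ δ > (0:ℝ), ∃ T > (0:ℝ), ∃ k₀ : ℕ, 2 * T < t₀ / ε k₀ ∧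
      ∀ k ≥ k₀, ∀ τ ∈ Set.Icc T (t₀ / ε k), ‖ye k τ - η (σf τ g0) (x0 (ε k * τ))‖ ≤ δ := by
    intro δ hδ
    by_contra! hcon
    have hcon' : ∀ j : ℕ, ∃ k ≥ j, ∃ τ, τ ∈ Icc (j + 1 : ℝ) (t₀ / ε k) ∧
        δ < ‖ye k τ - η (σf τ g0) (x0 (ε k * τ))‖ := by
      intro j
      obtain ⟨k₀, hk₀, hj⟩ :=
        ((hΘ.eventually_gt_atTop (2 * (j + 1 : ℝ))).and (eventually_ge_atTop j)).exists
      obtain ⟨k, hk, τ, hτ, hlt⟩ := hcon (j + 1) (by positivity) k₀ hk₀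
      exact ⟨k, hj.trans hk, τ, hτ, hlt⟩
    choose κ hκ τ hτj hlt using hcon'
    have hκ' : Tendsto κ (hyperfilter ℕ : Filter ℕ) atTop :=
      (tendsto_atTop_mono hκ tendsto_id).mono_left hU
    have hτ : ∀ j, τ j ∈ Icc 0 (t₀ / ε (κ j)) := fun j =>
      ⟨by linarith [(hτj j).1, (Nat.cast_nonneg j : (0 : ℝ) ≤ j)], (hτj j).2⟩
    obtain ⟨h, x, hx, hh, hu, hx'⟩ := hcpt (hyperfilter ℕ) κ τ hτ
    have hwin : ∀ a : ℝ, ∀ᶠ j in (hyperfilter ℕ : Filter ℕ), ∀ s ∈ Icc a 0,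
        τ j + s ∈ Icc 0 (t₀ / ε (κ j)) := by
      intro a
      obtain ⟨N, hN⟩ := exists_nat_ge (-a)
      filter_upwards [hU (eventually_ge_atTop N)] with j hj s hs
      have hj' : (N : ℝ) ≤ j := by exact_mod_cast hj
      exact ⟨by linarith [(hτj j).1, hs.1], by linarith [(hτj j).2, hs.2]⟩
    obtain ⟨T, hT0, hT⟩ := hUB R hR0
    obtain ⟨w, hw0, hwb, hw⟩ := exists_bounded_entire_solution_of_ultrafilter (hL h x) (hsol h x)
      hu hT0.le (fun j => hT x hx (τ j))
      (y := fun j s => ye (κ j) (τ j + s)) (ξ := fun j s => xe (κ j) (τ j + s))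
      (fun a => (hwin a).mono fun j hj s hs => hyeshift _ _ _ (hj s hs))
      (fun a ρ hρ => by
        filter_upwards [hwin a,
          eventually_norm_sub_le_of_slow hεpos hεlim hx0cont hconv hκ' hτ hx' (-a) hρ]
          with j h1 h2 s hs
        exact h2 s (by rw [abs_of_nonpos hs.2]; linarith [hs.1]) (h1 s hs))
      (fun a => by
        filter_upwards [hwin a, hκ'.eventually hR] with j h1 h2 s hs using h2 _ (h1 s hs))
    have hmem : w 0 ∈ attrFiber ev h x := ⟨w, rfl, hwb, hw⟩
    rw [hη h x (hKtube hx), mem_singleton_iff] at hmem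
    have hηj := hηlim hh hx' (fun j => mem_image_of_mem x0 (hslow _ _ (hτ j))) hx
    have hdiff := (hw0.sub hηj).norm
    simp only [hmem, sub_self, norm_zero, add_zero] at hdiff
    obtain ⟨j, hj⟩ := (hdiff.eventually (gt_mem_nhds hδ)).exists
    exact (hlt j).not_gt hj
  have hfinal : Tendsto (fun k : ℕ => ‖ye k (t₀ / ε k) - η (σf (t₀ / ε k) g0) (x0 t₀)‖)
      atTop (𝓝 0) := by
    refine Metric.tendsto_nhds.2 fun δ hδ => ?_
    obtain ⟨T, hT0, k₀, hk₀, hT⟩ := key (δ / 2) (half_pos hδ)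
    filter_upwards [eventually_ge_atTop k₀] with k hk
    have hle : t₀ / ε k₀ ≤ t₀ / ε k :=
      div_le_div_of_nonneg_left ht₀.le (hεpos k) (hεanti.antitone hk)
    have := hT k hk (t₀ / ε k) ⟨by linarith, le_rfl⟩
    rw [mul_div_cancel₀ _ (hεpos k).ne'] at this
    rw [dist_zero_right, norm_norm]
    linarith
  refine ⟨key, hfinal, fun h₀ hh₀ => ⟨?_, ?_⟩⟩
  · refine mem_iInter₂.2 fun s _ => mem_closure_of_tendsto hh₀ ?_
    filter_upwards [hΘ.eventually_ge_atTop s] with k hk using ⟨_, hk, rfl⟩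
  · have ht₀K : x0 t₀ ∈ K := mem_image_of_mem x0 ⟨ht₀.le, le_rfl⟩
    have hlim := hηlim hh₀ tendsto_const_nhds (fun _ => ht₀K) ht₀K
    simpa using (tendsto_zero_iff_norm_tendsto_zero.2 hfinal).add hlim
end

section
/- Given any compact set K₀ ⊂ ℝⁿ and any h ∈ O(g), the solutions of the family of equations y' = h(x,y,τ), x ∈ K₀, are defined for all forward time and are uniformly ultimately bounded: there is c > 0 such that for every d > 0 there is T(d) > 0 with |y(τ+τ₀, h, x, τ₀, y₀)| ≤ c whenever x ∈ K₀, τ₀ ∈ ℝ, τ ≥ T(d) and |y₀| ≤ d. -/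
open Filter Topology Metric Set

/-- If `w` solves `w' = F t w`, `z` solves `z' = G t z` with `‖z‖ ≤ R`, both start at the same
point, `F` is Lipschitz on the ball of radius `R + 1`, and `F` is close to `G` along `z`,
then `w` stays close to `z`. -/
theorem norm_sub_le_of_perturbed_ode {E : Type*} [NormedAddCommGroup E] [NormedSpace ℝ E]
    {F G : ℝ → E → E} {w z : ℝ → E} {a b R L η : ℝ} (hab : a ≤ b) (hL : 0 < L) (hη : 0 < η)
    (hη1 : η * Real.exp ((L + 1) * (b - a)) ≤ 1)
    (hw : ∀ t ∈ Icc a b, HasDerivAt w (F t (w t)) t)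
    (hz : ∀ t ∈ Icc a b, HasDerivAt z (G t (z t)) t)
    (hinit : w a = z a) (hR : ∀ t ∈ Icc a b, ‖z t‖ ≤ R)
    (hF : ∀ t, ∀ y₁ ∈ closedBall (0 : E) (R + 1), ∀ y₂ ∈ closedBall (0 : E) (R + 1),
      ‖F t y₁ - F t y₂‖ ≤ L * ‖y₁ - y₂‖)
    (hFG : ∀ t ∈ Icc a b, ‖F t (z t) - G t (z t)‖ < η) :
    ‖w b - z b‖ ≤ η * Real.exp ((L + 1) * (b - a)) := by
  have hd : ∀ t ∈ Icc a b,
      HasDerivAt (fun t => w t - z t) (F t (w t) - G t (z t)) t :=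
    fun t ht => (hw t ht).sub (hz t ht)
  have hB : ∀ t, HasDerivAt (fun t => η * Real.exp ((L + 1) * (t - a)))
      ((L + 1) * (η * Real.exp ((L + 1) * (t - a)))) t := by
    intro t
    have h := ((((hasDerivAt_id t).sub_const a).const_mul (L + 1)).exp).const_mul η
    exact h.congr_deriv (by simp only [id, mul_one]; ring)
  refine image_norm_le_of_norm_deriv_right_lt_deriv_boundary
    (fun t ht => (hd t ht).continuousAt.continuousWithinAt)
    (fun t ht => (hd t (Ico_subset_Icc_self ht)).hasDerivWithinAt)
    (by simp [hinit, hη.le]) hB ?_ (right_mem_Icc.2 hab)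
  intro t ht heq
  have ht' := Ico_subset_Icc_self ht
  have hle : η * Real.exp ((L + 1) * (t - a)) ≤ η * Real.exp ((L + 1) * (b - a)) := by
    have := ht'.2
    gcongr
  have hge : η ≤ η * Real.exp ((L + 1) * (t - a)) :=
    le_mul_of_one_le_right hη.le (Real.one_le_exp (by have := ht'.1; nlinarith))
  have hzR := hR t ht'
  have hwR : ‖w t‖ ≤ R + 1 := by
    have h1 := norm_add_le (w t - z t) (z t)
    rw [sub_add_cancel] at h1
    linarith
  have h1 := hF t (w t) (by simpa using hwR) (z t) (by simpa using hzR.trans (by linarith))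
  have h2 := norm_add_le (F t (w t) - F t (z t)) (F t (z t) - G t (z t))
  rw [sub_add_sub_cancel] at h2
  have h3 := hFG t ht'
  rw [heq] at h1
  linarith

/-- On a compact set, a map with index in the omega-limit set is uniformly approximated by maps
with index arbitrarily late in the forward orbit. -/
theorem exists_approx_of_mem_omegaSet {H X Y : Type*} [TopologicalSpace H] [TopologicalSpace X]
    [PseudoMetricSpace Y] {ev : H → C(X, Y)} (hev : Continuous ev) {σf : ℝ → H → H} {g0 h : H}
    (hh : h ∈ omegaSet σf g0) {K : Set X} (hK : IsCompact K) {ε : ℝ} (hε : 0 < ε) (r : ℝ) :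
    ∃ s, 0 ≤ s ∧ r ≤ s ∧ ∀ p ∈ K, dist (ev (σf s g0) p) (ev h p) < ε := by
  have h1 := ContinuousMap.tendsto_iff_forall_isCompact_tendstoUniformlyOn.1 (hev.tendsto h) K hK
  have h2 := Metric.tendstoUniformlyOn_iff.1 h1 ε hε
  have h3 := mem_iInter₂.1 hh (max 0 r) (le_max_left 0 r)
  obtain ⟨_, hs, s, hrs, rfl⟩ := mem_closure_iff_nhds.1 h3 _ h2
  exact ⟨s, (le_max_left _ _).trans hrs, (le_max_right _ _).trans hrs, fun p hp => by
    rw [dist_comm]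
    exact hs p hp⟩

/-- under the relaxed assumptions, for every h ∈ O(g) the solutions of the family y' = h(x,y,τ), x ∈ K₀, are globally defined forwards and uniformly ultimately bounded. -/
theorem stmt_17
    {n m : ℕ} (hn : 1 ≤ n) (hm : 1 ≤ m)
    -- g, admissible and Lipschitz in y on compacts
    (g : C(EuclideanSpace ℝ (Fin n) × EuclideanSpace ℝ (Fin m) × ℝ,
      EuclideanSpace ℝ (Fin m)))
    (hadm : IsAdmissibleMap g) (hlip : IsLipschitzInY g)
    -- the hull H of g, a compact metric space with the continuous shift flow,
    -- identified via the embedding ev with the closure of the translates of g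
    (H : Type) [MetricSpace H] [CompactSpace H]
    (σf : ℝ → H → H)
    (hσcont : Continuous fun p : ℝ × H => σf p.1 p.2)
    (hσ0 : ∀ h, σf 0 h = h)
    (hσadd : ∀ s t : ℝ, ∀ h, σf (s + t) h = σf s (σf t h))
    (ev : H → C(EuclideanSpace ℝ (Fin n) × EuclideanSpace ℝ (Fin m) × ℝ,
      EuclideanSpace ℝ (Fin m)))
    (hev : Topology.IsEmbedding ev)
    (hrange : Set.range ev = closure {h | ∃ s : ℝ, h = timeTranslate s g})
    (g0 : H) (hg0 : ev g0 = g)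
    (hequiv : ∀ (s : ℝ) (h : H), ev (σf s h) = timeTranslate s (ev h))
    -- the (unique, maximal) solutions y(τ,h,x,τ₀,y₀) of y' = h(x,y,τ)
    (sol : H → EuclideanSpace ℝ (Fin n) → ℝ → EuclideanSpace ℝ (Fin m) → ℝ →
      EuclideanSpace ℝ (Fin m))
    (hsolinit : ∀ h x τ₀ y₀, sol h x τ₀ y₀ τ₀ = y₀)
    -- (H1'): solutions over the forward orbit of g and over O(g) are globally
    -- defined in the future
    (hsolodeO : ∀ h ∈ omegaSet σf g0, ∀ x (τ₀ : ℝ) y₀ (τ : ℝ), τ₀ ≤ τ →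
      HasDerivAt (sol h x τ₀ y₀) (ev h (x, sol h x τ₀ y₀ τ, τ)) τ)
    (hsolodeG : ∀ s : ℝ, 0 ≤ s → ∀ x (τ₀ : ℝ) y₀ (τ : ℝ), 0 ≤ τ₀ → τ₀ ≤ τ →
      HasDerivAt (sol (σf s g0) x τ₀ y₀) (ev (σf s g0) (x, sol (σf s g0) x τ₀ y₀ τ, τ)) τ)
    -- (H2'): uniform ultimate boundedness on [0,∞) over compact sets of parameters
    (hH2' : ∀ K₀ : Set (EuclideanSpace ℝ (Fin n)), IsCompact K₀ →
      ∃ c > (0:ℝ), ∀ d > (0:ℝ), ∃ T > (0:ℝ), ∀ x ∈ K₀, ∀ τ₀ : ℝ, 0 ≤ τ₀ → ∀ τ ≥ T,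
        ∀ y₀ : EuclideanSpace ℝ (Fin m), ‖y₀‖ ≤ d → ‖sol g0 x τ₀ y₀ (τ + τ₀)‖ ≤ c)
 :
    ∀ K₀ : Set (EuclideanSpace ℝ (Fin n)), IsCompact K₀ →
      ∀ h ∈ omegaSet σf g0,
        (∀ x ∈ K₀, ∀ (τ₀ : ℝ) y₀ (τ : ℝ), τ₀ ≤ τ →
          HasDerivAt (sol h x τ₀ y₀) (ev h (x, sol h x τ₀ y₀ τ, τ)) τ) ∧
        ∃ c > (0:ℝ), ∀ d > (0:ℝ), ∃ T > (0:ℝ), ∀ x ∈ K₀, ∀ τ₀ : ℝ, ∀ τ ≥ T,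
          ∀ y₀ : EuclideanSpace ℝ (Fin m), ‖y₀‖ ≤ d → ‖sol h x τ₀ y₀ (τ + τ₀)‖ ≤ c := by
  intro K₀ hK₀ h hh
  refine ⟨fun x _ => hsolodeO h hh x, ?_⟩
  obtain ⟨c, hc, hcT⟩ := hH2' K₀ hK₀
  refine ⟨c, hc, fun d hd => ?_⟩
  obtain ⟨T, hT, hb⟩ := hcT d hd
  refine ⟨T, hT, fun x hx τ₀ τ hτ y₀ hy₀ => ?_⟩
  have hab : τ₀ ≤ τ + τ₀ := by linarith
  have hz : ∀ t ∈ Icc τ₀ (τ + τ₀),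
      HasDerivAt (sol h x τ₀ y₀) (ev h (x, sol h x τ₀ y₀ t, t)) t :=
    fun t ht => hsolodeO h hh x τ₀ y₀ t ht.1
  obtain ⟨R, hR⟩ := isCompact_Icc.exists_bound_of_continuousOn
    (fun t ht => (hz t ht).continuousAt.continuousWithinAt)
  obtain ⟨L, hL, hLip⟩ := hlip K₀ hK₀ (closedBall 0 (R + 1)) (isCompact_closedBall _ _)
  refine le_of_forall_pos_le_add fun δ hδ => ?_
  set M := Real.exp ((L + 1) * (τ + τ₀ - τ₀)) with hM
  have hM0 : 0 < M := Real.exp_pos _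
  set η := min 1 δ / M with hηdef
  have hη : 0 < η := div_pos (lt_min one_pos hδ) hM0
  have hηM : η * M = min 1 δ := div_mul_cancel₀ _ hM0.ne'
  obtain ⟨s, hs0, hs, happrox⟩ := exists_approx_of_mem_omegaSet hev.continuous hh
    ((isCompact_singleton (x := x)).prod
      ((isCompact_closedBall (0 : EuclideanSpace ℝ (Fin m)) R).prod
        (isCompact_Icc (a := τ₀) (b := τ + τ₀)))) hη (-τ₀)
  have hs' : 0 ≤ τ₀ + s := by linarith
  have hw : ∀ t ∈ Icc τ₀ (τ + τ₀),
      HasDerivAt (fun t => sol g0 x (τ₀ + s) y₀ (t + s))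
        (g (x, sol g0 x (τ₀ + s) y₀ (t + s), t + s)) t := by
    intro t ht
    have h1 := hsolodeG 0 le_rfl x (τ₀ + s) y₀ (t + s) hs' (by linarith [ht.1])
    rw [hσ0, hg0] at h1
    exact h1.comp_add_const t s
  have hclose := norm_sub_le_of_perturbed_ode (F := fun t y => g (x, y, t + s))
    (G := fun t y => ev h (x, y, t)) hab hL hη (hηM.trans_le (min_le_left _ _)) hw hz
    (by simp only [hsolinit]) hR (fun t y₁ h₁ y₂ h₂ => hLip x hx y₁ h₁ y₂ h₂ (t + s))
    (fun t ht => by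
      have h1 := happrox (x, sol h x τ₀ y₀ t, t) ⟨rfl, by simpa using hR t ht, ht⟩
      rw [hequiv, hg0, dist_eq_norm] at h1
      exact h1)
  have hwc := hb x hx (τ₀ + s) hs' τ hτ y₀ hy₀
  rw [← add_assoc] at hwc
  have htri := norm_le_norm_add_norm_sub (sol g0 x (τ₀ + s) y₀ (τ + τ₀ + s))
    (sol h x τ₀ y₀ (τ + τ₀))
  have hmin := hclose.trans (hηM.trans_le (min_le_right _ _))
  linarith
end
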